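/- arXiv:1310.8090 — 8 statements merged into one kernel-verified Lean document; each statement's English description precedes it below -/
import Mathlib

section
/- (Cubical Sperner lemma) Let n ≥ 1 and k ≥ 1 be integers, and let φ : C(k) → {0,1,…,n} be a map such that (i) if x ∈ C_i^-(k) then φ(x) < i, and (ii) if x ∈ C_i^+(k) then φ(x) ≠ i−1. Then there exists a subcube C ⊆ C(k) such that φ(C) = {0,1,…,n}. -/
/-- The combinatorial `n`-cube `C(k) = [0,1]^n ∩ (k⁻¹ℤ)^n`. -/
def combCube (n k : ℕ) : Set (Fin n → ℝ) :=
  {x | ∀ i, x i ∈ Set.Icc (0 : ℝ) 1 ∧ ∃ m : ℤ, x i = (m : ℝ) / k}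

/-- The subcube `{ z₀ + Σ_i a_i e_i : a ∈ {0,1}^n }` of `(k⁻¹ℤ)^n` with base point `z₀`,
where `e_i` has all coordinates zero except the `i`-th, which is `1/k`. -/
def subcube (n k : ℕ) (z₀ : Fin n → ℝ) : Set (Fin n → ℝ) :=
  {x | ∃ a : Fin n → Bool, x = fun j => z₀ j + if a j then (1 : ℝ) / k else 0}

open Finset

/-- The simplices of the Kuhn triangulation of the grid `{0, …, k}^n`: pairs `(z, τ)` of a base
point and an enumeration of the coordinates, `τ i` being the step at which coordinate `i` is
raised. -/
def kuhnCells (n k : ℕ) : Finset ((Fin n → ℕ) × (Fin n → ℕ)) :=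
  ((Fintype.piFinset fun _ => range k) ×ˢ (Fintype.piFinset fun _ => range n)).filter
    fun s => Function.Injective s.2

/-- The `j`-th vertex of a Kuhn simplex. -/
def kuhnVertex {n : ℕ} (s : (Fin n → ℕ) × (Fin n → ℕ)) (j : ℕ) : Fin n → ℕ :=
  fun i => s.1 i + if s.2 i < j then 1 else 0

/-- The labels `f 0, …, f n` include all of `0, …, n`. -/
def FullLabels (n : ℕ) (f : ℕ → ℕ) : Prop :=
  ∀ c ≤ n, ∃ m ≤ n, f m = c

/-- The labels `f 0, …, f n` with `f j` omitted include all of `0, …, n - 1`. -/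
def DoorLabels (n : ℕ) (f : ℕ → ℕ) (j : ℕ) : Prop :=
  ∀ c < n, ∃ m ≤ n, m ≠ j ∧ f m = c

/-- The pair consisting of the simplex on the other side of the facet opposite to vertex `j`, and
the index of the vertex of that simplex opposite to this facet. -/
def kuhnOpposite (n : ℕ) (p : ((Fin n → ℕ) × (Fin n → ℕ)) × ℕ) :
    ((Fin n → ℕ) × (Fin n → ℕ)) × ℕ :=
  if p.2 = 0 then
    ((fun i => if p.1.2 i = 0 then p.1.1 i + 1 else p.1.1 i,
      fun i => if p.1.2 i = 0 then n - 1 else p.1.2 i - 1), n)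
  else if p.2 = n then
    ((fun i => if p.1.2 i = n - 1 then p.1.1 i - 1 else p.1.1 i,
      fun i => if p.1.2 i = n - 1 then 0 else p.1.2 i + 1), 0)
  else
    ((p.1.1, fun i => if p.1.2 i = p.2 - 1 then p.2 else if p.1.2 i = p.2 then p.2 - 1
      else p.1.2 i), p.2)

lemma mem_kuhnCells {n k : ℕ} {s : (Fin n → ℕ) × (Fin n → ℕ)} :
    s ∈ kuhnCells n k ↔ (∀ i, s.1 i < k) ∧ (∀ i, s.2 i < n) ∧ Function.Injective s.2 := by
  simp [kuhnCells, and_assoc]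

lemma exists_eq_of_injective_of_lt {n : ℕ} {t : Fin n → ℕ} (hlt : ∀ i, t i < n)
    (hinj : Function.Injective t) {m : ℕ} (hm : m < n) : ∃ i, t i = m := by
  have hinj' : Function.Injective fun i => (⟨t i, hlt i⟩ : Fin n) := by
    intro a b h
    exact hinj (by simpa using h)
  obtain ⟨i, hi⟩ := Finite.surjective_of_injective hinj' ⟨m, hm⟩
  exact ⟨i, by simpa using hi⟩

lemma kuhnVertex_le {n k : ℕ} {s : (Fin n → ℕ) × (Fin n → ℕ)} (hs : s ∈ kuhnCells n k) (j : ℕ)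
    (i : Fin n) : kuhnVertex s j i ≤ k := by
  have := (mem_kuhnCells.1 hs).1 i
  unfold kuhnVertex
  split_ifs <;> omega

open Classical in
/-- A simplex has an odd number of doors exactly when it is fully labelled. -/
lemma card_filter_doorLabels (n : ℕ) (f : ℕ → ℕ) (hf : ∀ m ≤ n, f m ≤ n) :
    (#{j ∈ range (n + 1) | DoorLabels n f j} : ZMod 2) = if FullLabels n f then 1 else 0 := by
  split_ifs with hfull
  · have himg : (range (n + 1)).image f = range (n + 1) := by
      ext c
      simp only [mem_image, mem_range, Nat.lt_succ_iff]
      exact ⟨fun ⟨m, hm, h⟩ => h ▸ hf m hm, hfull c⟩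
    have hinj : Set.InjOn f (range (n + 1)) := card_image_iff.1 (by rw [himg])
    obtain ⟨m₀, hm₀, hfm₀⟩ := hfull n le_rfl
    have : {j ∈ range (n + 1) | DoorLabels n f j} = {m₀} := by
      ext j
      simp only [mem_filter, mem_range, mem_singleton]
      constructor
      · rintro ⟨hj, hd⟩
        by_contra hne
        have hlt : f j < n := by
          refine lt_of_le_of_ne (hf j (by omega)) fun h => hne ?_
          exact hinj (by simpa using hj) (by simp; omega) (h.trans hfm₀.symm)
        obtain ⟨m, hm, hmj, h⟩ := hd _ hlt
        exact hmj (hinj (by simp; omega) (by simpa using hj) h)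
      · rintro rfl
        refine ⟨by omega, fun c hc => ?_⟩
        obtain ⟨m, hm, h⟩ := hfull c hc.le
        exact ⟨m, hm, by rintro rfl; omega, h⟩
    simp [this]
  · by_cases hex : ∃ j ≤ n, DoorLabels n f j
    · obtain ⟨j₀, hj₀, hd⟩ := hex
      have hlt : f j₀ < n := by
        by_contra hge
        refine hfull fun c hc => ?_
        rcases hc.lt_or_eq with h | h
        · obtain ⟨m, hm, -, h⟩ := hd c h
          exact ⟨m, hm, h⟩
        · exact ⟨j₀, hj₀, by have := hf j₀ hj₀; omega⟩
      have hcard : #((range (n + 1)).erase j₀) = n := by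
        rw [card_erase_of_mem (by simp; omega)]; simp
      have himg : range n = ((range (n + 1)).erase j₀).image f := by
        refine eq_of_subset_of_card_le (fun c hc => ?_) ?_
        · obtain ⟨m, hm, hmj, h⟩ := hd c (by simpa using hc)
          exact mem_image.2 ⟨m, by simp [hmj]; omega, h⟩
        · exact card_image_le.trans (by simp [hcard])
      have hinj : Set.InjOn f ((range (n + 1)).erase j₀) :=
        card_image_iff.1 (by rw [← himg, hcard, card_range])
      obtain ⟨j₁, hj₁, hne, h₁⟩ := hd _ hlt
      have : {j ∈ range (n + 1) | DoorLabels n f j} = {j₀, j₁} := by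
        ext j
        simp only [mem_filter, mem_range, mem_insert, mem_singleton]
        constructor
        · rintro ⟨hj, hdj⟩
          by_contra! hcon
          have hj' : j ∈ (range (n + 1)).erase j₀ := by simp [hcon.1]; omega
          have hlt' : f j < n := by
            have := mem_image_of_mem f hj'
            rwa [← himg, mem_range] at this
          obtain ⟨m, hm, hmj, h⟩ := hdj _ hlt'
          by_cases hm₀ : m = j₀
          · subst hm₀
            exact hcon.2 (hinj hj' (by simp [hne]; omega) (by omega))
          · exact hmj (hinj (by simp [hm₀]; omega) hj' h)
        · rintro (rfl | rfl)
          · exact ⟨by omega, hd⟩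
          · refine ⟨by omega, fun c hc => ?_⟩
            obtain ⟨m, hm, hmj, h⟩ := hd c hc
            by_cases hmj₁ : m = j
            · exact ⟨j₀, hj₀, hne.symm, by rw [← h, hmj₁, h₁]⟩
            · exact ⟨m, hm, hmj₁, h⟩
      rw [this, card_pair hne.symm]
      rfl
    · have : {j ∈ range (n + 1) | DoorLabels n f j} = ∅ := by
        ext j
        simp only [mem_filter, mem_range, notMem_empty, iff_false, not_and]
        exact fun hj hd => hex ⟨j, by omega, hd⟩
      simp [this]

/-- Crossing a facet leads to a simplex of the grid unless the facet lies in the boundary. -/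
lemma kuhnOpposite_mem {n k : ℕ} {p : ((Fin n → ℕ) × (Fin n → ℕ)) × ℕ}
    (hs : p.1 ∈ kuhnCells n k) (hj : p.2 ≤ n) (hup : p.2 = 0 → ∀ i, p.1.2 i = 0 → p.1.1 i + 1 < k) :
    (kuhnOpposite n p).1 ∈ kuhnCells n k ∧ (kuhnOpposite n p).2 ≤ n := by
  obtain ⟨⟨z, t⟩, j⟩ := p
  obtain ⟨hz, ht, hinj⟩ := mem_kuhnCells.1 hs
  dsimp only at *
  unfold kuhnOpposite
  rw [mem_kuhnCells]
  split_ifs with h0 hn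
  · refine ⟨⟨fun i => ?_, fun i => ?_, fun a b h => hinj ?_⟩, le_rfl⟩
    · have := hup h0 i
      have := hz i
      dsimp only
      split_ifs <;> omega
    · have := ht i
      dsimp only
      split_ifs <;> omega
    · have := ht a
      have := ht b
      dsimp only at h
      split_ifs at h <;> omega
  · refine ⟨⟨fun i => ?_, fun i => ?_, fun a b h => hinj ?_⟩, Nat.zero_le _⟩
    · have := hz i
      dsimp only
      split_ifs <;> omega
    · have := ht i
      dsimp only
      split_ifs <;> omega
    · have := ht a
      have := ht b
      dsimp only at h
      split_ifs at h <;> omega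
  · refine ⟨⟨hz, fun i => ?_, fun a b h => hinj ?_⟩, hj⟩
    · have := ht i
      dsimp only
      split_ifs <;> omega
    · dsimp only at h
      split_ifs at h <;> omega

lemma kuhnOpposite_kuhnOpposite {n k : ℕ} {p : ((Fin n → ℕ) × (Fin n → ℕ)) × ℕ}
    (hs : p.1 ∈ kuhnCells n k) (hn : n ≠ 0)
    (hdown : p.2 = n → ∀ i, p.1.2 i = n - 1 → p.1.1 i ≠ 0) :
    kuhnOpposite n (kuhnOpposite n p) = p := by
  obtain ⟨⟨z, t⟩, j⟩ := p
  obtain ⟨hz, ht, hinj⟩ := mem_kuhnCells.1 hs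
  dsimp only at *
  by_cases h0 : j = 0
  · subst h0
    simp only [kuhnOpposite, if_true, hn, if_false, Prod.mk.injEq, and_true]
    constructor <;> ext i <;> have := ht i <;> split_ifs <;> omega
  · by_cases hjn : j = n
    · subst hjn
      simp only [kuhnOpposite, if_true, h0, if_false, Prod.mk.injEq, and_true]
      constructor <;> ext i <;> have := ht i <;> have := hdown rfl i <;> split_ifs <;>
        first | contradiction | omega
    · simp only [kuhnOpposite, h0, hjn, if_false, Prod.mk.injEq, and_true, true_and]
      ext i
      split_ifs <;> omega

lemma kuhnOpposite_ne {n k : ℕ} {p : ((Fin n → ℕ) × (Fin n → ℕ)) × ℕ}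
    (hs : p.1 ∈ kuhnCells n k) (hn : n ≠ 0) (hj : p.2 ≤ n) : kuhnOpposite n p ≠ p := by
  obtain ⟨⟨z, t⟩, j⟩ := p
  obtain ⟨hz, ht, hinj⟩ := mem_kuhnCells.1 hs
  dsimp only at *
  intro h
  unfold kuhnOpposite at h
  dsimp only at h
  split_ifs at h with h0 hjn
  · have := congrArg Prod.snd h
    dsimp only at this
    omega
  · have := congrArg Prod.snd h
    dsimp only at this
    omega
  · obtain ⟨i, hi⟩ := exists_eq_of_injective_of_lt ht hinj (m := j) (by omega)
    have := congrFun (congrArg (fun q => q.1.2) h) i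
    dsimp only at this
    split_ifs at this <;> omega

/-- The facet crossed by `kuhnOpposite` is common to both simplices. -/
lemma doorLabels_kuhnOpposite {n k : ℕ} {p : ((Fin n → ℕ) × (Fin n → ℕ)) × ℕ}
    (hs : p.1 ∈ kuhnCells n k) (hj : p.2 ≤ n)
    (hdown : p.2 = n → ∀ i, p.1.2 i = n - 1 → p.1.1 i ≠ 0) (φ : (Fin n → ℕ) → ℕ)
    (hd : DoorLabels n (fun m => φ (kuhnVertex p.1 m)) p.2) :
    DoorLabels n (fun m => φ (kuhnVertex (kuhnOpposite n p).1 m)) (kuhnOpposite n p).2 := by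
  obtain ⟨⟨z, t⟩, j⟩ := p
  obtain ⟨hz, ht, hinj⟩ := mem_kuhnCells.1 hs
  dsimp only at *
  intro c hc
  obtain ⟨m, hm, hmj, h⟩ := hd c hc
  unfold kuhnOpposite
  dsimp only at h ⊢
  split_ifs with h0 hjn
  · refine ⟨m - 1, by omega, by omega, ?_⟩
    rw [← h]
    congr 1
    ext i
    have := ht i
    simp only [kuhnVertex]
    split_ifs <;> omega
  · refine ⟨m + 1, by omega, by omega, ?_⟩
    rw [← h]
    congr 1
    ext i
    have := ht i
    have := hdown hjn i
    simp only [kuhnVertex]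
    split_ifs <;> omega
  · refine ⟨m, hm, hmj, ?_⟩
    rw [← h]
    congr 1
    ext i
    simp only [kuhnVertex]
    split_ifs <;> omega

/-- The boundary facets labelled `0, …, n` are those of the fully labelled simplices of the face
on which the last coordinate vanishes. -/
lemma card_boundary_doors (n k : ℕ) (hk : 1 ≤ k) (φ : (Fin (n + 1) → ℕ) → ℕ)
    [DecidablePred fun p : ((Fin (n + 1) → ℕ) × (Fin (n + 1) → ℕ)) × ℕ =>
      DoorLabels (n + 1) (fun m => φ (kuhnVertex p.1 m)) p.2 ∧
        p.2 = n + 1 ∧ p.1.1 (Fin.last n) = 0 ∧ p.1.2 (Fin.last n) = n]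
    [DecidablePred fun s : (Fin n → ℕ) × (Fin n → ℕ) =>
      FullLabels n fun m => φ (Fin.snoc (kuhnVertex s m) 0)] :
    #{p ∈ kuhnCells (n + 1) k ×ˢ range (n + 2) |
      DoorLabels (n + 1) (fun m => φ (kuhnVertex p.1 m)) p.2 ∧
        p.2 = n + 1 ∧ p.1.1 (Fin.last n) = 0 ∧ p.1.2 (Fin.last n) = n} =
    #{s ∈ kuhnCells n k | FullLabels n fun m => φ (Fin.snoc (kuhnVertex s m) 0)} := by
  symm
  have hvert : ∀ (s : (Fin n → ℕ) × (Fin n → ℕ)) (m : ℕ), m ≤ n →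
      kuhnVertex ((Fin.snoc s.1 0 : Fin (n + 1) → ℕ), (Fin.snoc s.2 n : Fin (n + 1) → ℕ)) m =
        Fin.snoc (kuhnVertex s m) 0 := by
    intro s m hm
    ext i
    refine Fin.lastCases ?_ (fun i => ?_) i
    · simp [kuhnVertex, hm]
    · simp [kuhnVertex]
  refine card_bij
    (fun s _ => (((Fin.snoc s.1 0 : Fin (n + 1) → ℕ), (Fin.snoc s.2 n : Fin (n + 1) → ℕ)), n + 1))
    ?_ ?_ ?_
  · intro s hs
    obtain ⟨hs, hfull⟩ := mem_filter.1 hs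
    obtain ⟨hz, ht, hinj⟩ := mem_kuhnCells.1 hs
    refine mem_filter.2 ⟨mem_product.2 ⟨mem_kuhnCells.2 ⟨?_, ?_, ?_⟩, by simp⟩, ?_, rfl,
      by simp, by simp⟩
    · refine Fin.lastCases ?_ fun i => ?_
      · simp; omega
      · simpa using hz i
    · refine Fin.lastCases ?_ fun i => ?_
      · simp
      · simpa using (ht i).trans (Nat.lt_succ_self n)
    · refine Fin.snoc_injective_iff.2 ⟨hinj, ?_⟩
      rintro ⟨i, hi⟩
      exact (ht i).ne hi
    · intro c hc
      obtain ⟨m, hm, h⟩ := hfull c (by omega)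
      refine ⟨m, by omega, by dsimp only; omega, ?_⟩
      dsimp only
      rw [hvert s m hm]
      exact h
  · rintro ⟨z, t⟩ - ⟨z', t'⟩ - h
    simpa [Fin.snoc_inj] using h
  · rintro ⟨⟨z, t⟩, j⟩ hp
    obtain ⟨hp, hd, hj, hz0, htn⟩ := mem_filter.1 hp
    obtain ⟨hz, ht, hinj⟩ := mem_kuhnCells.1 (mem_product.1 hp).1
    dsimp only at *
    have hzs : (Fin.snoc (Fin.init z) 0 : Fin (n + 1) → ℕ) = z := by
      rw [← hz0]; exact Fin.snoc_init_self z
    have hts : (Fin.snoc (Fin.init t) n : Fin (n + 1) → ℕ) = t := by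
      calc _ = Fin.snoc (Fin.init t) (t (Fin.last n)) := by rw [htn]
        _ = t := Fin.snoc_init_self t
    refine ⟨(Fin.init z, Fin.init t), mem_filter.2 ⟨mem_kuhnCells.2 ⟨fun i => hz _, fun i => ?_,
      fun a b h => Fin.castSucc_injective n (hinj h)⟩, ?_⟩, by simp only [hzs, hts, hj]⟩
    · refine lt_of_le_of_ne (Nat.lt_succ_iff.1 (ht i.castSucc)) fun h => ?_
      exact (Fin.castSucc_lt_last i).ne (hinj (h.trans htn.symm))
    · intro c hc
      obtain ⟨m, hm, hmj, h⟩ := hd c (by omega)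
      refine ⟨m, by omega, ?_⟩
      dsimp only at h ⊢
      rw [← hvert _ m (by omega), hzs, hts]
      exact h

open Classical in
/-- The number of fully labelled simplices in the Kuhn triangulation of the grid is odd. -/
theorem card_fullLabels_odd (n k : ℕ) (hk : 1 ≤ k) (φ : (Fin n → ℕ) → ℕ)
    (hφ : ∀ x, (∀ i, x i ≤ k) → φ x ≤ n)
    (hminus : ∀ x, (∀ i, x i ≤ k) → ∀ i : Fin n, x i = 0 → φ x ≤ i)
    (hplus : ∀ x, (∀ i, x i ≤ k) → ∀ i : Fin n, x i = k → φ x ≠ i) :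
    (#{s ∈ kuhnCells n k | FullLabels n fun m => φ (kuhnVertex s m)} : ZMod 2) = 1 := by
  induction n with
  | zero =>
    have : {s ∈ kuhnCells 0 k | FullLabels 0 fun m => φ (kuhnVertex s m)} = {default} := by
      ext s
      simp only [mem_filter, mem_singleton, Subsingleton.elim s default, iff_true]
      refine ⟨mem_kuhnCells.2 ⟨fun i => i.elim0, fun i => i.elim0, fun i => i.elim0⟩,
        fun c hc => ⟨0, le_rfl, ?_⟩⟩
      have := hφ (kuhnVertex default 0) fun i => i.elim0
      dsimp only
      omega
    simp [this]
  | succ n ih =>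
    have hface := ih (fun x => φ (Fin.snoc x 0))
      (fun x hx => by
        simpa using hminus (Fin.snoc x 0)
          (Fin.lastCases (by simp) fun i => by simpa using hx i) (Fin.last n) (by simp))
      (fun x hx i hi => by
        simpa using hminus (Fin.snoc x 0)
          (Fin.lastCases (by simp) fun i => by simpa using hx i) i.castSucc (by simpa using hi))
      (fun x hx i hi => by
        simpa using hplus (Fin.snoc x 0)
          (Fin.lastCases (by simp) fun i => by simpa using hx i) i.castSucc (by simpa using hi))
    rw [← card_boundary_doors n k hk φ] at hface
    set D := {p ∈ kuhnCells (n + 1) k ×ˢ range (n + 2) |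
      DoorLabels (n + 1) (fun m => φ (kuhnVertex p.1 m)) p.2} with hD
    have hcount : (#D : ZMod 2) =
        #{s ∈ kuhnCells (n + 1) k | FullLabels (n + 1) fun m => φ (kuhnVertex s m)} := by
      rw [hD, card_filter, sum_product, card_filter]
      push_cast
      refine sum_congr rfl fun s hs => ?_
      rw [← card_filter_doorLabels (n + 1) (fun m => φ (kuhnVertex s m))
        (fun m _ => hφ _ (kuhnVertex_le hs m)), card_filter]
      push_cast
      rfl
    rw [← hcount, ← hface, ← filter_filter, ← hD,
      ← card_filter_add_card_filter_not (s := D) (fun p => p.2 = n + 1 ∧ p.1.1 (Fin.last n) = 0 ∧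
        p.1.2 (Fin.last n) = n)]
    push_cast
    rw [add_eq_left]
    have hup : ∀ p ∈ D, p.2 = 0 → ∀ i, p.1.2 i = 0 → p.1.1 i + 1 < k := by
      rintro ⟨s, j⟩ hp rfl i hi
      obtain ⟨hp, hd⟩ := mem_filter.1 hp
      have hs := (mem_product.1 hp).1
      have hz := (mem_kuhnCells.1 hs).1 i
      by_contra hge
      obtain ⟨m, hm, hm0, h⟩ := hd i i.2
      refine hplus _ (kuhnVertex_le hs m) i ?_ h
      dsimp only at *
      simp only [kuhnVertex]
      split_ifs <;> omega
    have hdown : ∀ p ∈ D, ¬ (p.2 = n + 1 ∧ p.1.1 (Fin.last n) = 0 ∧ p.1.2 (Fin.last n) = n) →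
        p.2 = n + 1 → ∀ i, p.1.2 i = n + 1 - 1 → p.1.1 i ≠ 0 := by
      rintro ⟨s, j⟩ hp hnb rfl i hi hzi
      obtain ⟨hp, hd⟩ := mem_filter.1 hp
      have hs := (mem_product.1 hp).1
      obtain ⟨m, hm, hmn, h⟩ := hd n (by omega)
      dsimp only at *
      have hle := hminus _ (kuhnVertex_le hs m) i (by simp only [kuhnVertex]; split_ifs <;> omega)
      have hi_last : i = Fin.last n := Fin.ext (by simp; omega)
      subst hi_last
      exact hnb ⟨rfl, hzi, hi⟩
    rw [card_eq_sum_ones]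
    push_cast
    have hmem : ∀ p, p ∈ D ↔ (p.1 ∈ kuhnCells (n + 1) k ∧ p.2 ≤ n + 1) ∧
        DoorLabels (n + 1) (fun m => φ (kuhnVertex p.1 m)) p.2 := by
      intro p
      simp [hD, Nat.lt_succ_iff]
    refine sum_involution (fun p _ => kuhnOpposite (n + 1) p) (fun _ _ => by decide) ?_ ?_ ?_
    · intro p hp _
      have hp := (hmem p).1 (mem_filter.1 hp).1
      exact kuhnOpposite_ne hp.1.1 n.succ_ne_zero hp.1.2
    · intro p hp
      obtain ⟨hpD, hnb⟩ := mem_filter.1 hp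
      have hp := (hmem p).1 hpD
      have hdn := hdown p hpD hnb
      refine mem_filter.2 ⟨(hmem _).2 ⟨kuhnOpposite_mem hp.1.1 hp.1.2 (hup p hpD),
        doorLabels_kuhnOpposite hp.1.1 hp.1.2 hdn φ hp.2⟩, ?_⟩
      unfold kuhnOpposite
      split_ifs with h0 hj
      · rintro ⟨-, hz, ht⟩
        dsimp only at hz ht
        have := (mem_kuhnCells.1 hp.1.1).2.1 (Fin.last n)
        split_ifs at hz ht
        omega
      · rintro ⟨h, -⟩
        simp at h
      · rintro ⟨h, -⟩
        exact hj h
    · intro p hp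
      obtain ⟨hpD, hnb⟩ := mem_filter.1 hp
      have hp := (hmem p).1 hpD
      exact kuhnOpposite_kuhnOpposite hp.1.1 n.succ_ne_zero (hdown p hpD hnb)


/-- **Cubical Sperner lemma.** If `φ : C(k) → {0,…,n}` satisfies
(i) `x ∈ C_i^-(k) ⇒ φ(x) < i` and (ii) `x ∈ C_i^+(k) ⇒ φ(x) ≠ i-1`
(faces indexed by `i = 1,…,n`, here `i : Fin n` stands for the index `i+1`),
then some subcube `C ⊆ C(k)` satisfies `φ(C) = {0,…,n}`. -/
theorem cubical_sperner (n k : ℕ) (hn : 1 ≤ n) (hk : 1 ≤ k)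
    (φ : (Fin n → ℝ) → ℕ) (hφ : ∀ x ∈ combCube n k, φ x ≤ n)
    (hminus : ∀ x ∈ combCube n k, ∀ i : Fin n, x i = 0 → φ x < i.val + 1)
    (hplus : ∀ x ∈ combCube n k, ∀ i : Fin n, x i = 1 → φ x ≠ i.val) :
    ∃ z₀ ∈ combCube n k, subcube n k z₀ ⊆ combCube n k ∧
      φ '' subcube n k z₀ = {m : ℕ | m ≤ n} := by
  classical
  have hk0 : (0 : ℝ) < k := by exact_mod_cast hk
  have hgrid : ∀ x : Fin n → ℕ, (∀ i, x i ≤ k) → (fun i => (x i : ℝ) / k) ∈ combCube n k := by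
    intro x hx i
    refine ⟨⟨by positivity, ?_⟩, x i, by simp⟩
    rw [div_le_one hk0]
    exact_mod_cast hx i
  have hodd := card_fullLabels_odd n k hk (fun x => φ fun i => (x i : ℝ) / k)
    (fun x hx => hφ _ (hgrid x hx))
    (fun x hx i hi => Nat.lt_succ_iff.1 (hminus _ (hgrid x hx) i (by simp [hi])))
    (fun x hx i hi => hplus _ (hgrid x hx) i (by simp [hi, hk0.ne']))
  obtain ⟨s, hs⟩ : {s ∈ kuhnCells n k |
      FullLabels n fun m => φ fun i => (kuhnVertex s m i : ℝ) / k}.Nonempty := by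
    rw [nonempty_iff_ne_empty]
    intro h
    rw [h] at hodd
    simp at hodd
  obtain ⟨hs, hfull⟩ := mem_filter.1 hs
  have hz := (mem_kuhnCells.1 hs).1
  have hsub : subcube n k (fun i => (s.1 i : ℝ) / k) ⊆ combCube n k := by
    rintro _ ⟨a, rfl⟩
    convert hgrid (fun i => s.1 i + if a i then 1 else 0)
      (fun i => by have := hz i; split_ifs <;> omega) using 2 with i
    split_ifs <;> simp [add_div]
  refine ⟨_, hgrid s.1 fun i => (hz i).le, hsub, Set.Subset.antisymm ?_ ?_⟩
  · rintro _ ⟨x, hx, rfl⟩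
    exact hφ x (hsub hx)
  · intro c hc
    obtain ⟨m, -, h⟩ := hfull c hc
    refine ⟨_, ⟨fun i => decide (s.2 i < m), rfl⟩, ?_⟩
    rw [← h]
    congr 1
    ext i
    by_cases hi : s.2 i < m <;> simp [kuhnVertex, hi, add_div]
end

section
/- Let S = [z_0,…,z_n] ⊆ (k⁻¹ℤ)^n be an n-simplex. Then for every i ∈ {0,…,n} there is a unique n-simplex S[i] in (k⁻¹ℤ)^n (the i-th neighbor of S) such that S ∩ S[i] = F_i(S), where F_i(S) = [z_0,…,z_{i−1},z_{i+1},…,z_n] is the i-th face of S. -/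
/-- The vector `e_i ∈ (k⁻¹ℤ)^n`: all coordinates zero except the `i`-th, which is `1/k`. -/
noncomputable def stdVec (n k : ℕ) (i : Fin n) : Fin n → ℝ := fun j => if j = i then (1 : ℝ) / k else 0

/-- An `n`-simplex in `(k⁻¹ℤ)^n`: an ordered tuple `[z_0,…,z_n]` of points of `(k⁻¹ℤ)^n`
with `z_j = z_{j-1} + e_{α(j)}` for `j = 1,…,n`, where `α` is a permutation of `{1,…,n}`. -/
def IsNSimplex (n k : ℕ) (z : Fin (n + 1) → Fin n → ℝ) : Prop :=
  (∀ j i, ∃ m : ℤ, z j i = (m : ℝ) / k) ∧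
  ∃ α : Equiv.Perm (Fin n), ∀ j : Fin n, z j.succ = z j.castSucc + stdVec n k (α j)

theorem stdVec_self (n k : ℕ) (i : Fin n) : stdVec n k i i = 1 / k := by
  simp [stdVec]

theorem stdVec_of_ne {n k : ℕ} {i j : Fin n} (h : j ≠ i) : stdVec n k i j = 0 := by
  simp [stdVec, h]

theorem stdVec_injective {n k : ℕ} (hk : 1 ≤ k) : Function.Injective (stdVec n k) := by
  intro i j h
  by_contra hij
  have h' := congrFun h i
  rw [stdVec_self, stdVec_of_ne hij] at h'
  have : (0 : ℝ) < 1 / k := by positivity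
  linarith

theorem sum_stdVec (n k : ℕ) (i : Fin n) : ∑ j, stdVec n k i j = 1 / k := by
  simp [stdVec]

/-- A vector `e_a` occurring in a sum of two of the `e_i` is one of the two summands. -/
theorem eq_or_eq_of_stdVec_add_eq {n k : ℕ} (hk : 1 ≤ k) {a b c d : Fin n}
    (h : stdVec n k a + stdVec n k b = stdVec n k c + stdVec n k d) : a = c ∨ a = d := by
  by_contra! hne
  have h' := congrFun h a
  simp only [Pi.add_apply, stdVec_self, stdVec_of_ne hne.1, stdVec_of_ne hne.2] at h'
  have h1 : (0 : ℝ) < 1 / k := by positivity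
  have h2 : 0 ≤ stdVec n k b a := by
    unfold stdVec
    split_ifs <;> positivity
  linarith

theorem exists_int_div_add_stdVec {n k : ℕ} {v : Fin n → ℝ}
    (hv : ∀ i, ∃ m : ℤ, v i = (m : ℝ) / k) (a i : Fin n) :
    ∃ m : ℤ, (v + stdVec n k a) i = (m : ℝ) / k := by
  obtain ⟨m, hm⟩ := hv i
  by_cases h : i = a
  · refine ⟨m + 1, ?_⟩
    rw [Pi.add_apply, hm, h, stdVec_self]
    push_cast
    ring
  · exact ⟨m, by rw [Pi.add_apply, hm, stdVec_of_ne h, add_zero]⟩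

namespace IsNSimplex

variable {n k : ℕ} {z w : Fin (n + 1) → Fin n → ℝ}

/-- The coordinate sum grows by `1 / k` along each step of a simplex. -/
theorem sum_apply (hz : IsNSimplex n k z) (j : Fin (n + 1)) :
    ∑ i, z j i = ∑ i, z 0 i + (j : ℝ) / k := by
  obtain ⟨-, α, hα⟩ := hz
  induction j using Fin.induction with
  | zero => simp
  | succ j ih =>
    simp only [hα, Pi.add_apply, Finset.sum_add_distrib, sum_stdVec, ih, Fin.val_castSucc,
      Fin.val_succ]
    push_cast
    ring

/-- Common vertices of two simplices occur with a constant shift of the index. -/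
theorem index_sub_eq (hk : 1 ≤ k) (hz : IsNSimplex n k z) (hw : IsNSimplex n k w)
    {j l j' l' : Fin (n + 1)} (h : z j = w l) (h' : z j' = w l') :
    (j : ℤ) - l = j' - l' := by
  have h1 := hz.sum_apply j
  have h2 := hz.sum_apply j'
  rw [h, hw.sum_apply l] at h1
  rw [h', hw.sum_apply l'] at h2
  have hk' : (k : ℝ) ≠ 0 := by positivity
  have h3 : ((j : ℝ) - l) / k = ((j' : ℝ) - l') / k := by
    rw [sub_div, sub_div]
    linarith
  rw [div_left_inj' hk'] at h3
  exact_mod_cast h3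

theorem injective (hk : 1 ≤ k) (hz : IsNSimplex n k z) : Function.Injective z := by
  intro a b h
  have := index_sub_eq hk hz hz h (rfl : z a = z a)
  ext
  omega

theorem last_eq (hz : IsNSimplex n k z) :
    z (Fin.last n) = z 0 + ∑ a, stdVec n k a := by
  obtain ⟨-, α, hα⟩ := hz
  have h : ∑ j : Fin n, (z j.succ - z j.castSucc) = ∑ a, stdVec n k a := by
    rw [← Equiv.sum_comp α (stdVec n k)]
    exact Finset.sum_congr rfl fun j _ => by rw [hα, add_sub_cancel_left]
  have h1 := Fin.sum_univ_succ z
  rw [Fin.sum_univ_castSucc] at h1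
  rw [← h, Finset.sum_sub_distrib]
  linear_combination h1

/-- Reversing the vertices of a simplex and reflecting them at the origin gives a simplex. -/
theorem neg_rev (hz : IsNSimplex n k z) : IsNSimplex n k fun j => -z j.rev := by
  obtain ⟨hL, α, hα⟩ := hz
  refine ⟨fun j i => ?_, Fin.revPerm.trans α, fun j => ?_⟩
  · obtain ⟨m, hm⟩ := hL j.rev i
    exact ⟨-m, by simp [hm, neg_div]⟩
  · simp only [Equiv.trans_apply, Fin.revPerm_apply, Fin.rev_succ, Fin.rev_castSucc, hα]
    abel

end IsNSimplex

/-- `T` is the vertex set of a simplex meeting the simplex `z` exactly in its `i`-th face. -/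
def IsNeighbor (n k : ℕ) (z : Fin (n + 1) → Fin n → ℝ) (i : Fin (n + 1))
    (T : Set (Fin n → ℝ)) : Prop :=
  (∃ w : Fin (n + 1) → Fin n → ℝ, IsNSimplex n k w ∧ T = Set.range w) ∧
    Set.range z ∩ T = Set.range z \ {z i}

theorem range_inter_eq_range_diff_iff {ι X : Type*} {z : ι → X} (hz : Function.Injective z)
    (i : ι) (T : Set X) :
    Set.range z ∩ T = Set.range z \ {z i} ↔ (∀ j ≠ i, z j ∈ T) ∧ z i ∉ T := by
  simp only [Set.ext_iff, Set.mem_inter_iff, Set.mem_sdiff, Set.mem_singleton_iff]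
  constructor
  · intro h
    refine ⟨fun j hj => ((h (z j)).2 ⟨⟨j, rfl⟩, fun e => hj (hz e)⟩).2, fun hi => ?_⟩
    exact ((h (z i)).1 ⟨⟨i, rfl⟩, hi⟩).2 rfl
  · rintro ⟨h1, h2⟩ x
    refine and_congr_right ?_
    rintro ⟨j, rfl⟩
    by_cases hj : j = i
    · subst hj
      simp [h2]
    · simp [h1 j hj, hz.ne hj]

theorem isNeighbor_range_iff {n k : ℕ} (hk : 1 ≤ k) {z w : Fin (n + 1) → Fin n → ℝ}
    (hz : IsNSimplex n k z) (hw : IsNSimplex n k w) (i : Fin (n + 1)) :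
    IsNeighbor n k z i (Set.range w) ↔
      (∀ j ≠ i, z j ∈ Set.range w) ∧ z i ∉ Set.range w := by
  rw [IsNeighbor, range_inter_eq_range_diff_iff (hz.injective hk)]
  exact and_iff_right ⟨w, hw, rfl⟩

/-- A simplex `w₀` whose vertex set is a neighbor is the only neighbor if every simplex satisfying
the same two conditions on the vertices equals `w₀`. -/
theorem existsUnique_isNeighbor_of {n k : ℕ} (hk : 1 ≤ k) {z w₀ : Fin (n + 1) → Fin n → ℝ}
    (hz : IsNSimplex n k z) (hw₀ : IsNSimplex n k w₀) {i : Fin (n + 1)}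
    (hmem : ∀ j ≠ i, z j ∈ Set.range w₀) (hnot : z i ∉ Set.range w₀)
    (huniq : ∀ w, IsNSimplex n k w → (∀ j ≠ i, z j ∈ Set.range w) → z i ∉ Set.range w →
      w = w₀) :
    ∃! T, IsNeighbor n k z i T := by
  refine ⟨Set.range w₀, (isNeighbor_range_iff hk hz hw₀ i).2 ⟨hmem, hnot⟩, fun T hT => ?_⟩
  obtain ⟨w, hw, rfl⟩ := hT.1
  have h := (isNeighbor_range_iff hk hz hw i).1 hT
  rw [huniq w hw h.1 h.2]

theorem isNeighbor_neg_rev {n k : ℕ} {z : Fin (n + 1) → Fin n → ℝ} {i : Fin (n + 1)}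
    {T : Set (Fin n → ℝ)} (h : IsNeighbor n k z i T) :
    IsNeighbor n k (fun j => -z j.rev) i.rev (-T) := by
  have hr (u : Fin (n + 1) → Fin n → ℝ) : Set.range (fun j : Fin (n + 1) => -u j.rev) = -Set.range u := by
    ext x
    simp only [Set.mem_range, Set.mem_neg]
    exact ⟨fun ⟨j, hj⟩ => ⟨j.rev, by rw [← hj, neg_neg]⟩,
      fun ⟨j, hj⟩ => ⟨j.rev, by rw [Fin.rev_rev, hj, neg_neg]⟩⟩
  obtain ⟨⟨w, hw, rfl⟩, hT⟩ := h
  refine ⟨⟨_, hw.neg_rev, (hr w).symm⟩, ?_⟩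
  rw [hr, ← Set.inter_neg, hT]
  ext x
  simp [neg_eq_iff_eq_neg]

theorem isNeighbor_neg_rev_iff {n k : ℕ} {z : Fin (n + 1) → Fin n → ℝ} {i : Fin (n + 1)}
    {T : Set (Fin n → ℝ)} :
    IsNeighbor n k (fun j => -z j.rev) i.rev (-T) ↔ IsNeighbor n k z i T :=
  ⟨fun h => by simpa using isNeighbor_neg_rev h, isNeighbor_neg_rev⟩

theorem existsUnique_isNeighbor_zero {m k : ℕ} (hk : 1 ≤ k)
    {z : Fin (m + 2) → Fin (m + 1) → ℝ} (hz : IsNSimplex (m + 1) k z) :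
    ∃! T, IsNeighbor (m + 1) k z 0 T := by
  obtain ⟨hL, α, hα⟩ := id hz
  set w₀ : Fin (m + 2) → Fin (m + 1) → ℝ :=
    Fin.snoc (α := fun _ => Fin (m + 1) → ℝ) (fun j : Fin (m + 1) => z j.succ)
      (z (Fin.last (m + 1)) + stdVec (m + 1) k (α 0)) with hw₀def
  have hcast (j : Fin (m + 1)) : w₀ j.castSucc = z j.succ := by simp [hw₀def]
  have hlast : w₀ (Fin.last (m + 1)) = z (Fin.last (m + 1)) + stdVec (m + 1) k (α 0) := by
    simp [hw₀def]
  have hw₀ : IsNSimplex (m + 1) k w₀ := by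
    refine ⟨fun j => ?_, (finRotate (m + 1)).trans α, fun j => ?_⟩
    · cases j using Fin.lastCases with
      | last =>
        rw [hlast]
        exact exists_int_div_add_stdVec (hL _) _
      | cast j =>
        rw [hcast]
        exact hL _
    · rw [Equiv.trans_apply, finRotate_apply, hcast]
      cases j using Fin.lastCases with
      | last => rw [Fin.succ_last, hlast, Fin.last_add_one]
      | cast q => rw [Fin.succ_castSucc, hcast, hα, Fin.coeSucc_eq_succ]
  refine existsUnique_isNeighbor_of hk hz hw₀ (fun j hj => ?_) ?_ fun w hw hmem hnot => ?_
  · obtain ⟨q, rfl⟩ := Fin.exists_succ_eq.2 hj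
    exact ⟨q.castSucc, hcast q⟩
  · rintro ⟨l, hl⟩
    have := IsNSimplex.index_sub_eq hk hz hw₀ hl.symm (hcast 0).symm
    simp at this
    omega
  obtain ⟨l, hl⟩ := hmem (Fin.succ 0) (Fin.succ_ne_zero 0)
  obtain ⟨p, hp⟩ := hmem (Fin.last _) (Fin.last_pos.ne')
  have hlp := IsNSimplex.index_sub_eq hk hz hw hl.symm hp.symm
  have hle : (l : ℕ) ≤ 1 := by
    simp at hlp
    omega
  have hl0 : (l : ℕ) = 0 := by
    by_contra hl0
    refine hnot ⟨0, ?_⟩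
    have hpl : p = Fin.last _ := by
      ext
      simp at hlp ⊢
      omega
    rw [hpl, hw.last_eq, hz.last_eq] at hp
    exact add_right_cancel hp
  have hws (q : Fin (m + 1)) : w q.castSucc = z q.succ := by
    obtain ⟨r, hr⟩ := hmem q.succ (Fin.succ_ne_zero q)
    have hrl := IsNSimplex.index_sub_eq hk hz hw hl.symm hr.symm
    have : r = q.castSucc := by
      ext
      simp at hrl ⊢
      omega
    rw [← this, hr]
  funext j
  cases j using Fin.lastCases with
  | cast q => rw [hws, hcast]
  | last =>
    rw [hw.last_eq, hw₀.last_eq, ← Fin.castSucc_zero, hws, hcast]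

theorem existsUnique_isNeighbor_last {m k : ℕ} (hk : 1 ≤ k)
    {z : Fin (m + 2) → Fin (m + 1) → ℝ} (hz : IsNSimplex (m + 1) k z) :
    ∃! T, IsNeighbor (m + 1) k z (Fin.last (m + 1)) T := by
  have h := existsUnique_isNeighbor_zero hk hz.neg_rev
  rw [← Fin.rev_last] at h
  refine ((Equiv.neg _).existsUnique_congr fun {T} => ?_).2 h
  exact isNeighbor_neg_rev_iff.symm

theorem existsUnique_isNeighbor_interior {m k : ℕ} (hk : 1 ≤ k)
    {z : Fin (m + 2) → Fin (m + 1) → ℝ} (hz : IsNSimplex (m + 1) k z) (p : Fin m) :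
    ∃! T, IsNeighbor (m + 1) k z p.succ.castSucc T := by
  obtain ⟨hL, α, hα⟩ := id hz
  set i : Fin (m + 2) := p.succ.castSucc with hi
  have hi' : p.castSucc.succ = i := by rw [hi, Fin.succ_castSucc]
  have hab : p.castSucc ≠ p.succ := Fin.castSucc_lt_succ.ne
  set w₀ := Function.update z i (z p.castSucc.castSucc + stdVec (m + 1) k (α p.succ)) with hw₀def
  have hself : w₀ i = z p.castSucc.castSucc + stdVec (m + 1) k (α p.succ) := by simp [hw₀def]
  have hne {j} (hj : j ≠ i) : w₀ j = z j := by simp [hw₀def, hj]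
  have hprev : p.castSucc.castSucc ≠ i := by simp [hi, Fin.ext_iff]
  have hnext : p.succ.succ ≠ i := by simp [hi, Fin.ext_iff]
  have hza := hα p.castSucc
  have hzb := hα p.succ
  rw [hi'] at hza
  rw [← hi] at hzb
  have hw₀ : IsNSimplex (m + 1) k w₀ := by
    refine ⟨fun j => ?_, (Equiv.swap p.castSucc p.succ).trans α, fun j => ?_⟩
    · by_cases hj : j = i
      · rw [hj, hself]
        exact exists_int_div_add_stdVec (hL _) _
      · rw [hne hj]
        exact hL _
    · rw [Equiv.trans_apply]
      by_cases ha : j = p.castSucc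
      · rw [ha, Equiv.swap_apply_left, hi', hself, hne hprev]
      by_cases hb : j = p.succ
      · rw [hb, Equiv.swap_apply_right, ← hi, hself, hne hnext, hzb, hza]
        abel
      rw [Equiv.swap_apply_of_ne_of_ne ha hb, hne, hne, hα]
      · exact fun h => hb (Fin.castSucc_injective _ h)
      · exact fun h => ha (Fin.succ_injective _ (h.trans hi'.symm))
  refine existsUnique_isNeighbor_of hk hz hw₀ (fun j hj => ⟨j, hne hj⟩) ?_
    fun w hw hmem hnot => ?_
  · rintro ⟨l, hl⟩
    by_cases hli : l = i
    · rw [hli, hself, hza] at hl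
      exact hab (α.injective (stdVec_injective hk (add_left_cancel hl))).symm
    · rw [hne hli] at hl
      exact hli (hz.injective hk hl)
  have hwz {j} (hj : j ≠ i) : w j = z j := by
    obtain ⟨a, ha⟩ := hmem 0 (by simp [hi, Fin.ext_iff])
    obtain ⟨b, hb⟩ := hmem (Fin.last _) (by have := p.isLt; simp [hi, Fin.ext_iff]; omega)
    obtain ⟨r, hr⟩ := hmem j hj
    have h1 := IsNSimplex.index_sub_eq hk hz hw ha.symm hb.symm
    have h2 := IsNSimplex.index_sub_eq hk hz hw ha.symm hr.symm
    have : r = j := by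
      ext
      simp at h1 h2
      omega
    rw [← this, hr, this]
  funext j
  by_cases hj : j = i
  · obtain ⟨-, β, hβ⟩ := id hw
    have hwa := hβ p.castSucc
    have hwb := hβ p.succ
    rw [hi', hwz hprev] at hwa
    rw [← hi, hwz hnext, hzb, hza, hwa, add_assoc, add_assoc] at hwb
    rcases eq_or_eq_of_stdVec_add_eq hk (add_left_cancel hwb).symm with h | h
    · exact absurd ⟨i, by rw [hwa, hza, h]⟩ hnot
    · rw [hj, hself, hwa, h]
  · rw [hwz hj, hne hj]


/-- For every `n`-simplex `S = [z_0,…,z_n] ⊆ (k⁻¹ℤ)^n` and every `i ∈ {0,…,n}` there is a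
unique `n`-simplex `S[i]` (the `i`-th neighbor of `S`) such that
`S ∩ S[i] = F_i(S) = [z_0,…,z_{i-1},z_{i+1},…,z_n]` (as sets of points). -/
theorem neighbor_existsUnique (n k : ℕ) (hn : 1 ≤ n) (hk : 1 ≤ k)
    (z : Fin (n + 1) → Fin n → ℝ) (hz : IsNSimplex n k z) (i : Fin (n + 1)) :
    ∃! T : Set (Fin n → ℝ),
      (∃ w : Fin (n + 1) → Fin n → ℝ, IsNSimplex n k w ∧ T = Set.range w) ∧
      Set.range z ∩ T = Set.range z \ {z i} := by
  obtain ⟨m, rfl⟩ := Nat.exists_eq_add_of_le' hn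
  change ∃! T, IsNeighbor (m + 1) k z i T
  cases i using Fin.lastCases with
  | last => exact existsUnique_isNeighbor_last hk hz
  | cast q =>
    cases q using Fin.cases with
    | zero => exact existsUnique_isNeighbor_zero hk hz
    | succ p => exact existsUnique_isNeighbor_interior hk hz p
end

section
/- (Higher connectedness of the cube, Kulpa) Let n ≥ 1 and for each i = 1,…,n let H_i^+, H_i^- ⊆ [0,1]^n be closed sets such that I_i^- ⊆ H_i^-, I_i^+ ⊆ H_i^+, and H_i^- ∪ H_i^+ = [0,1]^n. Then the intersection ∩_{i=1}^n (H_i^- ∩ H_i^+) is nonempty. -/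
namespace CubicalCochain

variable {ι : Type*} [DecidableEq ι]

/-- The coboundary modulo 2 of a cubical cochain on the lattice `ℕ^ι`. The value `C A b` is that
on the unit cube with lowest vertex `b` and set of edge directions `A`. -/
def coboundary (C : Finset ι → (ι → ℕ) → ZMod 2) (A : Finset ι) (b : ι → ℕ) : ZMod 2 :=
  ∑ i ∈ A, (C (A.erase i) (b + Pi.single i 1) + C (A.erase i) b)

/-- The cup product modulo 2 of the coboundaries of a list of functions on the lattice. -/
def cupProd : List ((ι → ℕ) → ZMod 2) → Finset ι → (ι → ℕ) → ZMod 2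
  | [], _, _ => 1
  | f :: fs, A, b =>
    ∑ i ∈ A, (f (b + Pi.single i 1) + f b) * cupProd fs (A.erase i) (b + Pi.single i 1)

theorem coboundary_coboundary (C : Finset ι → (ι → ℕ) → ZMod 2) (A : Finset ι) (b : ι → ℕ) :
    coboundary (coboundary C) A b = 0 := by
  simp only [coboundary, ← Finset.sum_add_distrib]
  rw [Finset.sum_sigma']
  refine Finset.sum_involution (fun p _ => ⟨p.2, p.1⟩) ?_ ?_ ?_ ?_
  · rintro ⟨i, j⟩ -
    simp only [Finset.erase_right_comm (a := j) (b := i),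
      add_right_comm b (Pi.single j 1) (Pi.single i 1)]
    grind [CharTwo.add_self_eq_zero]
  · rintro ⟨i, j⟩ h - e
    simp only [Finset.mem_sigma, Finset.mem_erase] at h
    grind
  · rintro ⟨i, j⟩ h
    simp only [Finset.mem_sigma, Finset.mem_erase] at h ⊢
    grind
  · rintro ⟨i, j⟩ -
    rfl

theorem cupProd_cons_of_coboundary_eq_zero (f : (ι → ℕ) → ZMod 2)
    (fs : List ((ι → ℕ) → ZMod 2)) (A : Finset ι) (b : ι → ℕ)
    (h : coboundary (cupProd fs) A b = 0) :
    cupProd (f :: fs) A b = coboundary (fun A b => f b * cupProd fs A b) A b := by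
  rw [← add_zero (cupProd (f :: fs) A b), ← mul_zero (f b), ← h]
  simp only [cupProd, coboundary, Finset.mul_sum, ← Finset.sum_add_distrib]
  refine Finset.sum_congr rfl fun i _ => ?_
  linear_combination f b * CharTwo.add_self_eq_zero (cupProd fs (A.erase i) (b + Pi.single i 1))

theorem coboundary_cupProd (fs : List ((ι → ℕ) → ZMod 2)) (A : Finset ι) (b : ι → ℕ) :
    coboundary (cupProd fs) A b = 0 := by
  induction fs generalizing A b with
  | nil => exact Finset.sum_eq_zero fun _ _ => CharTwo.add_self_eq_zero 1
  | cons f fs ih =>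
    have h : cupProd (f :: fs) = coboundary (fun A b => f b * cupProd fs A b) := by
      ext A b
      exact cupProd_cons_of_coboundary_eq_zero f fs A b (ih A b)
    rw [h, coboundary_coboundary]

theorem cupProd_cons (f : (ι → ℕ) → ZMod 2) (fs : List ((ι → ℕ) → ZMod 2))
    (A : Finset ι) (b : ι → ℕ) :
    cupProd (f :: fs) A b = coboundary (fun A b => f b * cupProd fs A b) A b :=
  cupProd_cons_of_coboundary_eq_zero f fs A b (coboundary_cupProd fs A b)

/-- The vertices of the unit cube with lowest vertex `b` and set of edge directions `A`. -/
def cubeVertices (A : Finset ι) (b : ι → ℕ) : Set (ι → ℕ) :=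
  {z | ∀ j, b j ≤ z j ∧ z j ≤ b j + if j ∈ A then 1 else 0}

theorem self_mem_cubeVertices (A : Finset ι) (b : ι → ℕ) : b ∈ cubeVertices A b :=
  fun _ => ⟨le_rfl, Nat.le_add_right _ _⟩

theorem cubeVertices_erase_subset {A : Finset ι} {i : ι} (hi : i ∈ A) (b : ι → ℕ) :
    cubeVertices (A.erase i) (b + Pi.single i 1) ⊆ cubeVertices A b := by
  intro z hz j
  have := hz j
  by_cases hj : j = i
  · subst hj
    simp_all
    omega
  · simp_all

theorem exists_ne_of_cupProd_ne_zero {fs : List ((ι → ℕ) → ZMod 2)} {A : Finset ι} {b : ι → ℕ}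
    (h : cupProd fs A b ≠ 0) {f : (ι → ℕ) → ZMod 2} (hf : f ∈ fs) :
    ∃ z ∈ cubeVertices A b, ∃ w ∈ cubeVertices A b, f z ≠ f w := by
  induction fs generalizing A b with
  | nil => simp at hf
  | cons g fs ih =>
    obtain ⟨i, hi, hne⟩ := Finset.exists_ne_zero_of_sum_ne_zero h
    have hsub := cubeVertices_erase_subset hi b
    rcases List.mem_cons.1 hf with rfl | hf
    · refine ⟨_, hsub (self_mem_cubeVertices _ _), b, self_mem_cubeVertices _ _, fun e => ?_⟩
      exact hne (by rw [e, CharTwo.add_self_eq_zero, zero_mul])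
    · obtain ⟨z, hz, w, hw, hzw⟩ := ih (right_ne_zero_of_mul hne) hf
      exact ⟨z, hsub hz, w, hsub hw, hzw⟩

variable [Fintype ι]

/-- The lattice points of the box with side `N` in the directions of `A`, whose other
coordinates agree with those of `b`. -/
def box (N : ℕ) (A : Finset ι) (b : ι → ℕ) : Finset (ι → ℕ) :=
  Fintype.piFinset fun i => if i ∈ A then Finset.range N else {b i}

theorem mem_box {N : ℕ} {A : Finset ι} {b y : ι → ℕ} :
    y ∈ box N A b ↔ ∀ i, if i ∈ A then y i < N else y i = b i := by
  simp only [box, Fintype.mem_piFinset]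
  refine forall_congr' fun i => ?_
  split_ifs <;> simp

theorem sum_box_eq_sum_range (N : ℕ) {A : Finset ι} {i : ι} (hi : i ∈ A) (b : ι → ℕ)
    (F : (ι → ℕ) → ZMod 2) :
    ∑ y ∈ box N A b, F y =
      ∑ t ∈ Finset.range N, ∑ y ∈ box N (A.erase i) (Function.update b i t), F y := by
  have hmaps : ∀ y ∈ box N A b, y i ∈ Finset.range N := fun y hy => by
    simpa [hi] using mem_box.1 hy i
  rw [← Finset.sum_fiberwise_of_maps_to hmaps]
  refine Finset.sum_congr rfl fun t ht => Finset.sum_congr ?_ fun _ _ => rfl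
  ext y
  rw [Finset.mem_filter, mem_box, mem_box]
  constructor
  · rintro ⟨h, rfl⟩ j
    have := h j
    by_cases hj : j = i
    · subst hj
      simp
    · simpa [hj] using this
  · intro h
    have hyi : y i = t := by simpa using h i
    refine ⟨fun j => ?_, hyi⟩
    by_cases hj : j = i
    · subst hj
      simpa [hi, hyi] using ht
    · simpa [hj] using h j

theorem sum_box_shift (N : ℕ) {A : Finset ι} {i : ι} (hi : i ∉ A) (b : ι → ℕ) (t : ℕ)
    (F : (ι → ℕ) → ZMod 2) :
    ∑ y ∈ box N A (Function.update b i t), F (y + Pi.single i 1) =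
      ∑ y ∈ box N A (Function.update b i (t + 1)), F y := by
  refine Finset.sum_bij' (fun y _ => y + Pi.single i 1) (fun y _ => y - Pi.single i 1)
    ?_ ?_ ?_ ?_ fun _ _ => rfl
  · intro y hy
    rw [mem_box] at hy ⊢
    intro j
    have := hy j
    by_cases hj : j = i
    · subst hj
      simpa [hi] using this
    · simpa [hj] using this
  · intro y hy
    rw [mem_box] at hy ⊢
    intro j
    have := hy j
    by_cases hj : j = i
    · subst hj
      simp_all
    · simpa [hj] using this
  · intro y _
    exact add_tsub_cancel_right _ _
  · intro y hy
    have h := mem_box.1 hy i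
    refine tsub_add_cancel_of_le fun j => ?_
    by_cases hj : j = i
    · subst hj
      simp_all
    · simp [hj]

theorem sum_box_coboundary (N : ℕ) (C : Finset ι → (ι → ℕ) → ZMod 2) (A : Finset ι)
    (b : ι → ℕ) :
    ∑ y ∈ box N A b, coboundary C A y =
      ∑ i ∈ A, (∑ y ∈ box N (A.erase i) (Function.update b i N), C (A.erase i) y +
        ∑ y ∈ box N (A.erase i) (Function.update b i 0), C (A.erase i) y) := by
  simp only [coboundary]
  rw [Finset.sum_comm]
  refine Finset.sum_congr rfl fun i hi => ?_
  rw [sum_box_eq_sum_range N hi]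
  simp only [Finset.sum_add_distrib, sum_box_shift N (Finset.notMem_erase i A)]
  rw [← Finset.sum_add_distrib]
  simp only [← CharTwo.sub_eq_add]
  exact Finset.sum_range_sub
    (fun t => ∑ y ∈ box N (A.erase i) (Function.update b i t), C (A.erase i) y) N

theorem sum_box_cupProd {N : ℕ} {l : ι → (ι → ℕ) → ZMod 2} (h0 : ∀ i y, y i = 0 → l i y = 0)
    (h1 : ∀ i y, y i = N → l i y = 1) {L : List ι} (hL : L.Nodup) (b : ι → ℕ) :
    ∑ y ∈ box N L.toFinset b, cupProd (L.map l) L.toFinset y = 1 := by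
  induction L generalizing b with
  | nil =>
    have : box N ∅ b = {b} := by
      ext y
      simp [mem_box, funext_iff]
    simp [cupProd, this]
  | cons k L ih =>
    obtain ⟨hk, hL⟩ := List.nodup_cons.1 hL
    have hfix {A : Finset ι} {i : ι} {c : ℕ} {y : ι → ℕ} (hi : i ∉ A)
        (hy : y ∈ box N A (Function.update b i c)) : y i = c := by
      simpa [hi] using mem_box.1 hy i
    have hvan {A : Finset ι} {i : ι} {y : ι → ℕ} (hi : i ∉ A) (hiL : i ∈ L)
        (hy : y i = 0 ∨ y i = N) : cupProd (L.map l) A y = 0 := by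
      by_contra hne
      obtain ⟨z, hz, w, hw, hzw⟩ :=
        exists_ne_of_cupProd_ne_zero hne (List.mem_map_of_mem (f := l) hiL)
      have hz' : z i = y i := by simpa [hi, le_antisymm_iff, and_comm] using hz i
      have hw' : w i = y i := by simpa [hi, le_antisymm_iff, and_comm] using hw i
      rcases hy with hy | hy
      · exact hzw (by rw [h0 i z (hz'.trans hy), h0 i w (hw'.trans hy)])
      · exact hzw (by rw [h1 i z (hz'.trans hy), h1 i w (hw'.trans hy)])
    simp only [List.map_cons, cupProd_cons]
    rw [sum_box_coboundary, Finset.sum_eq_single k]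
    · have hA : (k :: L).toFinset.erase k = L.toFinset := by simp [hk]
      have hk' : k ∉ L.toFinset := by simpa using hk
      rw [hA, Finset.sum_congr rfl fun y hy => by rw [h1 k y (hfix hk' hy), one_mul],
        ih hL, Finset.sum_eq_zero fun y hy => by rw [h0 k y (hfix hk' hy), zero_mul], add_zero]
    · intro i hi hik
      have hiL : i ∈ L := by simpa [hik] using hi
      have hiA := Finset.notMem_erase i (k :: L).toFinset
      rw [Finset.sum_eq_zero, Finset.sum_eq_zero, add_zero]
      · intro y hy
        rw [hvan hiA hiL (Or.inl (hfix hiA hy)), mul_zero]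
      · intro y hy
        rw [hvan hiA hiL (Or.inr (hfix hiA hy)), mul_zero]
    · simp

/-- A cubical form of Sperner's lemma. -/
theorem exists_forall_cube_ne {N : ℕ} {l : ι → (ι → ℕ) → ZMod 2}
    (h0 : ∀ i y, y i = 0 → l i y = 0) (h1 : ∀ i y, y i = N → l i y = 1) :
    ∃ b : ι → ℕ, ∀ i, ∃ z ∈ cubeVertices Finset.univ b, ∃ w ∈ cubeVertices Finset.univ b,
      l i z ≠ l i w := by
  have h := sum_box_cupProd h0 h1 (Finset.nodup_toList Finset.univ) 0
  rw [Finset.toList_toFinset] at h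
  obtain ⟨b, -, hb⟩ := Finset.exists_ne_zero_of_sum_ne_zero (h.trans_ne one_ne_zero)
  exact ⟨b, fun i => exists_ne_of_cupProd_ne_zero hb (List.mem_map_of_mem (by simp))⟩

end CubicalCochain

section GridPoint

variable {ι : Type*}

/-- The point `y / N` of the cube `[0,1]^ι`, with the coordinates above `1` replaced by `1`. -/
noncomputable def gridPoint (N : ℕ) (y : ι → ℕ) : ι → unitInterval :=
  fun i => Set.projIcc 0 1 zero_le_one ((y i : ℝ) / N)

theorem dist_gridPoint_le [Fintype ι] [DecidableEq ι] {N : ℕ} {b z : ι → ℕ}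
    (hz : z ∈ CubicalCochain.cubeVertices Finset.univ b) :
    dist (gridPoint N b) (gridPoint N z) ≤ 1 / N := by
  refine (dist_pi_le_iff (by positivity)).2 fun i => ?_
  have hp := (LipschitzWith.projIcc (zero_le_one (α := ℝ))).dist_le_mul ((b i : ℝ) / N) (z i / N)
  refine hp.trans ?_
  have hi := hz i
  simp only [Finset.mem_univ, if_true] at hi
  have h1 : (b i : ℝ) ≤ z i := by exact_mod_cast hi.1
  have h2 : (z i : ℝ) ≤ b i + 1 := by exact_mod_cast hi.2
  rw [NNReal.coe_one, one_mul, Real.dist_eq, ← sub_div, abs_div, Nat.abs_cast]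
  gcongr
  rw [abs_le]
  constructor <;> linarith

theorem exists_infDist_le [Fintype ι] {N : ℕ} (hN : N ≠ 0) {Hm Hp : ι → Set (ι → unitInterval)}
    (hm : ∀ i, {x : ι → unitInterval | x i = 0} ⊆ Hm i)
    (hp : ∀ i, {x : ι → unitInterval | x i = 1} ⊆ Hp i) (hcov : ∀ i, Hm i ∪ Hp i = Set.univ) :
    ∃ x : ι → unitInterval, ∀ i,
      Metric.infDist x (Hm i) ≤ 1 / N ∧ Metric.infDist x (Hp i) ≤ 1 / N := by
  classical
  let l : ι → (ι → ℕ) → ZMod 2 := fun i y =>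
    if y i = 0 ∨ (y i ≠ N ∧ gridPoint N y ∈ Hm i) then 0 else 1
  have hl0 {i : ι} {y : ι → ℕ} (h : l i y = 0) : gridPoint N y ∈ Hm i := by
    simp only [l, ite_eq_left_iff, one_ne_zero, imp_false, not_not] at h
    rcases h with h | h
    · exact hm i (by simp [gridPoint, h])
    · exact h.2
  have hl1 {i : ι} {y : ι → ℕ} (h : l i y ≠ 0) : gridPoint N y ∈ Hp i := by
    by_cases hy : y i = N
    · exact hp i (by simp [gridPoint, hy, hN])
    · have hc := hcov i ▸ Set.mem_univ (gridPoint N y)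
      refine hc.resolve_left fun hmem => h ?_
      simp [l, hy, hmem]
  obtain ⟨b, hb⟩ := CubicalCochain.exists_forall_cube_ne (N := N) (l := l)
    (fun i y h => by simp [l, h]) (fun i y h => by simp [l, h, hN])
  have key {i : ι} {z w : ι → ℕ} (hz : z ∈ CubicalCochain.cubeVertices Finset.univ b)
      (hw : w ∈ CubicalCochain.cubeVertices Finset.univ b) (h0 : l i z = 0) (h1 : l i w ≠ 0) :
      Metric.infDist (gridPoint N b) (Hm i) ≤ 1 / N ∧
        Metric.infDist (gridPoint N b) (Hp i) ≤ 1 / N :=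
    ⟨(Metric.infDist_le_dist_of_mem (hl0 h0)).trans (dist_gridPoint_le hz),
      (Metric.infDist_le_dist_of_mem (hl1 h1)).trans (dist_gridPoint_le hw)⟩
  refine ⟨gridPoint N b, fun i => ?_⟩
  obtain ⟨z, hz, w, hw, hzw⟩ := hb i
  by_cases h : l i z = 0
  · exact key hz hw h fun h' => hzw (h.trans h'.symm)
  · refine key hw hz ?_ h
    by_contra h'
    exact hzw ((Fin.eq_one_of_ne_zero _ h).trans (Fin.eq_one_of_ne_zero _ h').symm)

end GridPoint


/-- **Higher connectedness of the cube (Kulpa).** If, for `i = 1,…,n`, `H_i^-` and `H_i^+` are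
closed subsets of `[0,1]^n` with `I_i^- ⊆ H_i^-`, `I_i^+ ⊆ H_i^+` and `H_i^- ∪ H_i^+ = [0,1]^n`
(where `I_i^± = {x : x_i = 0 resp. 1}` are the faces), then `⋂_i (H_i^- ∩ H_i^+) ≠ ∅`. -/
theorem kulpa_higher_connectedness (n : ℕ) (hn : 1 ≤ n)
    (Hm Hp : Fin n → Set (Fin n → unitInterval))
    (hHmClosed : ∀ i, IsClosed (Hm i)) (hHpClosed : ∀ i, IsClosed (Hp i))
    (hm : ∀ i : Fin n, {x : Fin n → unitInterval | x i = 0} ⊆ Hm i)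
    (hp : ∀ i : Fin n, {x : Fin n → unitInterval | x i = 1} ⊆ Hp i)
    (hcov : ∀ i, Hm i ∪ Hp i = Set.univ) :
    (⋂ i, Hm i ∩ Hp i).Nonempty := by
  choose x hx using fun N : ℕ => exists_infDist_le N.succ_ne_zero hm hp hcov
  obtain ⟨a, φ, hφ, ha⟩ := CompactSpace.tendsto_subseq x
  have hlim : Filter.Tendsto (fun k => 1 / ((φ k).succ : ℝ)) Filter.atTop (nhds 0) := by
    simpa [Function.comp_def] using (tendsto_one_div_add_atTop_nhds_zero_nat (𝕜 := ℝ)).comp hφ.tendsto_atTop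
  have hmem {H : Set (Fin n → unitInterval)} (hc : IsClosed H) (hne : H.Nonempty)
      (hd : ∀ N : ℕ, Metric.infDist (x N) H ≤ 1 / (N.succ : ℝ)) : a ∈ H := by
    refine (hc.mem_iff_infDist_zero hne).2 (le_antisymm ?_ Metric.infDist_nonneg)
    exact le_of_tendsto_of_tendsto' (((Metric.continuous_infDist_pt H).tendsto a).comp ha) hlim
      fun k => hd (φ k)
  refine ⟨a, Set.mem_iInter.2 fun i => ⟨?_, ?_⟩⟩
  · exact hmem (hHmClosed i) ⟨0, hm i rfl⟩ fun N => (hx N i).1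
  · exact hmem (hHpClosed i) ⟨1, hp i rfl⟩ fun N => (hx N i).2
end

section
/- Let (X,d) be a metric space, let {K_i}_{i∈I} be a family of compact subsets of X, and let {S_k}_{k∈ℕ} be a sequence of subsets of X such that diam(S_k) → 0 as k → ∞ and S_k ∩ K_i ≠ ∅ for all k ∈ ℕ and all i ∈ I. Then ∩_{i∈I} K_i ≠ ∅. -/
/-- Let `(X,d)` be a metric space, `{K_i}_{i ∈ I}` a family of compact subsets, and
`{S_k}_{k ∈ ℕ}` a sequence of subsets with `diam(S_k) → 0` such that `S_k ∩ K_i ≠ ∅`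
for all `k` and `i`. Then `⋂_i K_i ≠ ∅`. -/
theorem iInter_nonempty_of_diam_tendsto_zero {X : Type*} [MetricSpace X]
    {ι : Type*} [Nonempty ι] (K : ι → Set X) (hK : ∀ i, IsCompact (K i))
    (S : ℕ → Set X)
    (hdiam : Filter.Tendsto (fun k => EMetric.diam (S k)) Filter.atTop (nhds 0))
    (hmeet : ∀ (k : ℕ) (i : ι), (S k ∩ K i).Nonempty) :
    (⋂ i, K i).Nonempty := by
  obtain ⟨i₀⟩ := ‹Nonempty ι›
  choose x hxS hxK using hmeet
  obtain ⟨a, -, φ, hφ, hlim⟩ := (hK i₀).tendsto_subseq fun k => hxK k i₀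
  refine ⟨a, Set.mem_iInter.2 fun i => ?_⟩
  refine (hK i).isClosed.mem_of_tendsto (f := fun n => x (φ n) i) (b := Filter.atTop) ?_
    (Filter.Eventually.of_forall fun n => hxK (φ n) i)
  rw [tendsto_iff_edist_tendsto_0] at hlim ⊢
  have hsum := (hdiam.comp hφ.tendsto_atTop).add hlim
  rw [add_zero] at hsum
  refine tendsto_of_tendsto_of_tendsto_of_le_of_le tendsto_const_nhds hsum
    (fun _ => zero_le) fun n => ?_
  exact (edist_triangle _ (x (φ n) i₀) _).trans
    (add_le_add_left (Metric.edist_le_ediam_of_mem (hxS (φ n) i) (hxS (φ n) i₀)) _)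
end

section
/- (van Mill) Let n ≥ 1 and let A_1, B_1, …, A_{n+1}, B_{n+1} ⊆ [0,1]^n be closed sets such that A_i ∩ B_i = ∅ for all i = 1,…,n+1. Then for each i there exists a closed set C_i ⊆ [0,1]^n separating A_i and B_i such that ∩_{i=1}^{n+1} C_i = ∅. -/
/-- `C` separates `A` and `B` in the space `X`: the complement of `C` is the union of two
disjoint open sets `U`, `V` with `A ⊆ U` and `B ⊆ V`. -/
def Separates {X : Type*} [TopologicalSpace X] (A B C : Set X) : Prop :=
  ∃ U V : Set X, IsOpen U ∧ IsOpen V ∧ Disjoint U V ∧ A ⊆ U ∧ B ⊆ V ∧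
    Set.univ \ C = U ∪ V

/-- The continuous functions on the cube `[0,1]^n` that extend to `C¹` functions on `ℝ^n`. -/
def smoothCubeSubalgebra (n : ℕ) : Subalgebra ℝ C(Fin n → unitInterval, ℝ) where
  carrier := {h | ∃ G : (Fin n → ℝ) → ℝ, ContDiff ℝ 1 G ∧ ∀ x, h x = G (fun j => (x j : ℝ))}
  mul_mem' := by
    rintro a b ⟨G, hG, ha⟩ ⟨H, hH, hb⟩
    exact ⟨fun x => G x * H x, hG.mul hH, fun x => by simp [ha, hb]⟩
  add_mem' := by
    rintro a b ⟨G, hG, ha⟩ ⟨H, hH, hb⟩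
    exact ⟨fun x => G x + H x, hG.add hH, fun x => by simp [ha, hb]⟩
  algebraMap_mem' r := ⟨fun _ => r, contDiff_const, fun x => by simp⟩

theorem smoothCubeSubalgebra_separatesPoints (n : ℕ) :
    (smoothCubeSubalgebra n).SeparatesPoints := by
  intro x y hxy
  obtain ⟨j, hj⟩ := Function.ne_iff.mp hxy
  refine ⟨fun z => (z j : ℝ), ⟨⟨fun z => (z j : ℝ), by fun_prop⟩, ?_, rfl⟩, ?_⟩
  · exact ⟨fun z => z j, contDiff_apply ℝ ℝ j, fun _ => rfl⟩
  · exact fun h => hj (Subtype.ext h)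

/-- Disjoint closed subsets of the cube are separated, with room to spare, by a `C¹` function. -/
theorem exists_contDiff_lt_and_gt {n : ℕ} {A B : Set (Fin n → unitInterval)}
    (hA : IsClosed A) (hB : IsClosed B) (hAB : Disjoint A B) :
    ∃ G : (Fin n → ℝ) → ℝ, ContDiff ℝ 1 G ∧
      (∀ x ∈ A, G (fun j => (x j : ℝ)) < 1 / 4) ∧ ∀ x ∈ B, 3 / 4 < G (fun j => (x j : ℝ)) := by
  obtain ⟨f, hfA, hfB, -⟩ := exists_continuous_zero_one_of_isClosed hA hB hAB
  obtain ⟨⟨g, G, hG, hgG⟩, hg⟩ :=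
    ContinuousMap.exists_mem_subalgebra_near_continuousMap_of_separatesPoints
      (smoothCubeSubalgebra n) (smoothCubeSubalgebra_separatesPoints n) f (1 / 4) (by norm_num)
  have hlt (x : Fin n → unitInterval) : |G (fun j => (x j : ℝ)) - f x| < 1 / 4 := by
    have := (ContinuousMap.norm_coe_le_norm (g - f) x).trans_lt hg
    simpa [hgG] using this
  refine ⟨G, hG, fun x hx => ?_, fun x hx => ?_⟩
  · have h := abs_lt.mp (hlt x)
    have h0 : f x = 0 := hfA hx
    linarith
  · have h := abs_lt.mp (hlt x)
    have h1 : f x = 1 := hfB hx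
    linarith

/-- A level set of a continuous function separates any two sets on which the function is
respectively below and above the level. -/
theorem separates_level_set {X : Type*} [TopologicalSpace X] {A B : Set X} {g : X → ℝ}
    (hg : Continuous g) {c : ℝ} (hA : ∀ x ∈ A, g x < c) (hB : ∀ x ∈ B, c < g x) :
    Separates A B {x | g x = c} := by
  refine ⟨{x | g x < c}, {x | c < g x}, isOpen_lt hg continuous_const,
    isOpen_lt continuous_const hg, ?_, hA, hB, ?_⟩
  · exact Set.disjoint_left.mpr fun x (hx : g x < c) (hx' : c < g x) => lt_asymm hx hx'
  · ext x
    simp [lt_or_lt_iff_ne]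

/-- **(van Mill.)** Let `n ≥ 1` and let `A_1,B_1,…,A_{n+1},B_{n+1} ⊆ [0,1]^n` be closed sets
with `A_i ∩ B_i = ∅` for all `i`. Then for each `i` there is a closed set `C_i` separating
`A_i` and `B_i` such that `⋂_{i=1}^{n+1} C_i = ∅`. -/
theorem van_mill (n : ℕ) (hn : 1 ≤ n)
    (A B : Fin (n + 1) → Set (Fin n → unitInterval))
    (hA : ∀ i, IsClosed (A i)) (hB : ∀ i, IsClosed (B i))
    (hAB : ∀ i, A i ∩ B i = ∅) :
    ∃ C : Fin (n + 1) → Set (Fin n → unitInterval),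
      (∀ i, IsClosed (C i) ∧ Separates (A i) (B i) (C i)) ∧ ⋂ i, C i = ∅ := by
  choose G hG hGA hGB using fun i =>
    exists_contDiff_lt_and_gt (hA i) (hB i) (Set.disjoint_iff_inter_eq_empty.mpr (hAB i))
  -- The image of a `C¹` map `ℝ^n → ℝ^(n+1)` has dense complement.
  have hdense : Dense (Set.range fun x i => G i x)ᶜ :=
    (contDiff_pi.mpr hG).dense_compl_range_of_finrank_lt_finrank (by simp)
  obtain ⟨c, hc, hcball⟩ :=
    hdense.exists_dist_lt (fun _ : Fin (n + 1) => (1 / 2 : ℝ)) (ε := 1 / 4) (by norm_num)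
  have hci (i : Fin (n + 1)) : |1 / 2 - c i| < 1 / 4 :=
    (dist_le_pi_dist (fun _ : Fin (n + 1) => (1 / 2 : ℝ)) c i).trans_lt hcball
  have hcont (i : Fin (n + 1)) :
      Continuous fun x : Fin n → unitInterval => G i (fun j => (x j : ℝ)) :=
    (hG i).continuous.comp (by fun_prop)
  refine ⟨fun i => {x | G i (fun j => (x j : ℝ)) = c i}, fun i => ⟨?_, ?_⟩, ?_⟩
  · exact isClosed_eq (hcont i) continuous_const
  · have h := abs_lt.mp (hci i)
    exact separates_level_set (hcont i) (fun x hx => by linarith [hGA i x hx])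
      fun x hx => by linarith [hGB i x hx]
  · refine Set.eq_empty_of_forall_notMem fun x hx => hc ⟨fun j => (x j : ℝ), ?_⟩
    exact funext fun i => Set.mem_iInter.mp hx i
end

section
/- Let A, B ⊆ [0,1]^n be disjoint closed sets and let E ⊆ ℝ be a dense subset. Then there exists a closed set C ⊆ [0,1]^n separating A and B such that C ⊆ {x ∈ [0,1]^n : ∃ j ∈ {1,…,n}, x_j ∈ E}. -/
/-- `C` separates `A` and `B` as soon as it is the frontier of an open set which contains `A` and
whose closure misses `B`. -/
theorem separates_frontier {X : Type*} [TopologicalSpace X] {A B W : Set X} (hW : IsOpen W)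
    (hAW : A ⊆ W) (hWB : Disjoint (closure W) B) : Separates A B (frontier W) := by
  refine ⟨W, (closure W)ᶜ, hW, isClosed_closure.isOpen_compl,
    disjoint_compl_right.mono_left subset_closure, hAW, hWB.subset_compl_left, ?_⟩
  ext x
  have hx : x ∈ W → x ∈ closure W := fun h => subset_closure h
  simp only [hW.frontier_eq, Set.mem_sdiff, Set.mem_univ, Set.mem_union, Set.mem_compl_iff]
  tauto

/-- A point outside a closed set `B` has an open box neighbourhood whose closure misses `B` and
all of whose faces are at levels in the dense set `E`. -/
theorem exists_isOpen_box_frontier_subset {n : ℕ} {B : Set (Fin n → unitInterval)}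
    (hB : IsClosed B) {E : Set ℝ} (hE : Dense E) {a : Fin n → unitInterval} (ha : a ∉ B) :
    ∃ W : Set (Fin n → unitInterval), IsOpen W ∧ a ∈ W ∧ Disjoint (closure W) B ∧
      frontier W ⊆ {x | ∃ j, (x j : ℝ) ∈ E} := by
  obtain ⟨ε, hε, hball⟩ := Metric.isOpen_iff.1 hB.isOpen_compl a ha
  have hl (j : Fin n) : ∃ y ∈ E, (a j : ℝ) - ε < y ∧ y < a j :=
    hE.exists_between (by linarith)
  have hr (j : Fin n) : ∃ y ∈ E, (a j : ℝ) < y ∧ y < a j + ε :=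
    hE.exists_between (by linarith)
  choose l hlE hl using hl
  choose r hrE hr using hr
  set W : Set (Fin n → unitInterval) := {x | ∀ j, l j < x j ∧ (x j : ℝ) < r j} with hWdef
  have hc (j : Fin n) : Continuous fun x : Fin n → unitInterval => (x j : ℝ) := by fun_prop
  have hW : IsOpen W := by
    simp only [hWdef, Set.ofPred_forall]
    refine isOpen_iInter_of_finite fun j => ?_
    exact (isOpen_lt continuous_const (hc j)).inter (isOpen_lt (hc j) continuous_const)
  have hcl : closure W ⊆ {x | ∀ j, l j ≤ x j ∧ (x j : ℝ) ≤ r j} := by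
    refine closure_minimal (fun x hx j => ⟨(hx j).1.le, (hx j).2.le⟩) ?_
    simp only [Set.ofPred_forall]
    refine isClosed_iInter fun j => ?_
    exact (isClosed_le continuous_const (hc j)).inter (isClosed_le (hc j) continuous_const)
  refine ⟨W, hW, fun j => ⟨(hl j).2, (hr j).1⟩, ?_, ?_⟩
  · refine Set.disjoint_left.2 fun x hx => hball ((dist_pi_lt_iff hε).2 fun j => ?_)
    rw [Subtype.dist_eq, Real.dist_eq, abs_lt]
    constructor <;> linarith [hcl hx j, hl j, hr j]
  · rw [hW.frontier_eq]
    rintro x ⟨hx, hxW⟩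
    obtain ⟨j, hj⟩ := not_forall.1 hxW
    refine ⟨j, ?_⟩
    rcases (hcl hx j).1.eq_or_lt with h | h
    · exact h ▸ hlE j
    · rcases (hcl hx j).2.eq_or_lt with h' | h'
      · exact h' ▸ hrE j
      · exact absurd ⟨h, h'⟩ hj

/-- Let `A, B ⊆ [0,1]^n` be disjoint closed sets and `E ⊆ ℝ` dense. Then there is a closed
set `C` separating `A` and `B` with `C ⊆ {x ∈ [0,1]^n : ∃ j, x_j ∈ E}`. -/
theorem exists_separating_set_subset_dense_coords (n : ℕ)
    (A B : Set (Fin n → unitInterval)) (hA : IsClosed A) (hB : IsClosed B)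
    (hAB : A ∩ B = ∅) (E : Set ℝ) (hE : Dense E) :
    ∃ C : Set (Fin n → unitInterval), IsClosed C ∧ Separates A B C ∧
      C ⊆ {x : Fin n → unitInterval | ∃ j : Fin n, (x j : ℝ) ∈ E} := by
  obtain ⟨W, hW, hAW, hWB, hWE⟩ : ∃ W : Set (Fin n → unitInterval), IsOpen W ∧ A ⊆ W ∧
      Disjoint (closure W) B ∧ frontier W ⊆ {x | ∃ j, (x j : ℝ) ∈ E} := by
    refine hA.isCompact.induction_on (p := fun s => ∃ W : Set (Fin n → unitInterval),
      IsOpen W ∧ s ⊆ W ∧ Disjoint (closure W) B ∧ frontier W ⊆ {x | ∃ j, (x j : ℝ) ∈ E})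
      ⟨∅, by simp⟩ ?_ ?_ ?_
    · rintro s t hst ⟨W, hW, htW, h⟩
      exact ⟨W, hW, hst.trans htW, h⟩
    · rintro s t ⟨W, hW, hsW, hWB, hWE⟩ ⟨W', hW', htW', hWB', hWE'⟩
      refine ⟨W ∪ W', hW.union hW', Set.union_subset_union hsW htW', ?_, ?_⟩
      · rw [closure_union]
        exact hWB.union_left hWB'
      · refine (frontier_union_subset W W').trans (Set.union_subset ?_ ?_)
        · exact Set.inter_subset_left.trans hWE
        · exact Set.inter_subset_right.trans hWE'
    · intro a ha
      obtain ⟨W, hW, haW, h⟩ := exists_isOpen_box_frontier_subset hB hE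
        fun haB => (hAB ▸ Set.mem_inter ha haB : a ∈ (∅ : Set (Fin n → unitInterval)))
      exact ⟨W, mem_nhdsWithin_of_mem_nhds (hW.mem_nhds haW), W, hW, subset_rfl, h⟩
  exact ⟨frontier W, isClosed_frontier, separates_frontier hW hAW hWB, hWE⟩
end

section
/- The separation-dimension of [0,1]^n equals n. Explicitly: (upper bound) for any closed sets A_1, B_1, …, A_{n+1}, B_{n+1} ⊆ [0,1]^n with A_i ∩ B_i = ∅ for all i, there exist closed sets C_i separating A_i and B_i with ∩_{i=1}^{n+1} C_i = ∅; and (lower bound, for n ≥ 1) there exist closed sets A_1, B_1, …, A_n, B_n ⊆ [0,1]^n with A_i ∩ B_i = ∅ for all i, such that any closed sets C_i separating A_i and B_i satisfy ∩_{i=1}^n C_i ≠ ∅. -/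
section

open Finset

/-- The `m`-th vertex of the simplex of the Freudenthal triangulation based at `v` whose edges run
in the direction `c` at step `τ c`. -/
def freudenthalVertex {n : ℕ} (v : Fin n → ℕ) (τ : Equiv.Perm (Fin n)) (m : ℕ) : Fin n → ℕ :=
  fun c => v c + if (τ c : ℕ) < m then 1 else 0

/-- The `m`-th vertex of the facet, starting at `w`, of a Freudenthal simplex, where the direction
of step `0` is omitted. -/
def freudenthalFacetVertex {n : ℕ} (w : Fin (n + 1) → ℕ) (τ : Equiv.Perm (Fin (n + 1))) (m : ℕ) :
    Fin (n + 1) → ℕ :=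
  fun c => w c + if 0 < (τ c : ℕ) ∧ (τ c : ℕ) ≤ m then 1 else 0

lemma sum_freudenthal_prod_shift {n : ℕ} (s : ℕ → (Fin (n + 1) → ℕ) → ZMod 2)
    (v : Fin (n + 1) → ℕ) :
    ∑ τ : Equiv.Perm (Fin (n + 1)), ∏ i ∈ range n,
        (s i (freudenthalVertex v τ (i + 2)) + s i (freudenthalVertex v τ (i + 1))) =
      ∑ τ : Equiv.Perm (Fin (n + 1)), ∏ i ∈ range n,
        (s i (freudenthalVertex v τ (i + 1)) + s i (freudenthalVertex v τ i)) := by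
  let P (j : ℕ) (τ : Equiv.Perm (Fin (n + 1))) (i : ℕ) : ZMod 2 :=
    if i < j then s i (freudenthalVertex v τ (i + 1)) + s i (freudenthalVertex v τ i)
    else s i (freudenthalVertex v τ (i + 2)) + s i (freudenthalVertex v τ (i + 1))
  have step : ∀ j < n, ∑ τ, ∏ i ∈ range n, P j τ i = ∑ τ, ∏ i ∈ range n, P (j + 1) τ i := by
    intro j hj
    rw [← CharTwo.add_eq_zero, ← sum_add_distrib]
    let a : Fin (n + 1) := ⟨j, by omega⟩
    let b : Fin (n + 1) := ⟨j + 1, by omega⟩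
    have hab : a ≠ b := by simp [a, b]
    have hvert : ∀ (τ : Equiv.Perm (Fin (n + 1))) (m : ℕ), m ≠ j + 1 →
        freudenthalVertex v (Equiv.swap a b * τ) m = freudenthalVertex v τ m := by
      intro τ m hm
      funext c
      have : ((Equiv.swap a b (τ c) : Fin (n + 1)) : ℕ) < m ↔ (τ c : ℕ) < m := by
        rw [Equiv.swap_apply_def]
        split_ifs with h1 h2
        · simp only [h1, a, b]; omega
        · simp only [h2, a, b]; omega
        · rfl
      simp [freudenthalVertex, this]
    have hsum : ∀ τ : Equiv.Perm (Fin (n + 1)),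
        ∏ i ∈ range n, P j τ i + ∏ i ∈ range n, P (j + 1) τ i =
        (s j (freudenthalVertex v τ (j + 2)) + s j (freudenthalVertex v τ j)) *
          ∏ i ∈ (range n).erase j, P j τ i := by
      intro τ
      have hj' : j ∈ range n := mem_range.2 hj
      have h1 : ∏ i ∈ (range n).erase j, P (j + 1) τ i = ∏ i ∈ (range n).erase j, P j τ i := by
        refine prod_congr rfl fun i hi => ?_
        have : i ≠ j := (mem_erase.1 hi).1
        have h2 : i < j + 1 ↔ i < j := by omega
        simp only [P, h2]
      rw [← mul_prod_erase _ _ hj', ← mul_prod_erase _ (P (j + 1) τ) hj', h1, ← add_mul]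
      congr 1
      simp only [P, lt_irrefl, if_false, lt_add_iff_pos_right, zero_lt_one, if_true]
      linear_combination CharTwo.add_self_eq_zero (s j (freudenthalVertex v τ (j + 1)))
    refine sum_involution (fun τ _ => Equiv.swap a b * τ) ?_ ?_ (fun _ _ => mem_univ _) ?_
    · intro τ _
      rw [hsum, hsum, hvert _ _ (by omega), hvert _ _ (by omega)]
      have : ∏ i ∈ (range n).erase j, P j (Equiv.swap a b * τ) i =
          ∏ i ∈ (range n).erase j, P j τ i := by
        refine prod_congr rfl fun i hi => ?_
        have : i ≠ j := (mem_erase.1 hi).1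
        simp only [P]
        split_ifs
        · rw [hvert _ _ (by omega), hvert _ _ (by omega)]
        · rw [hvert _ _ (by omega), hvert _ _ (by omega)]
      rw [this]
      exact CharTwo.add_self_eq_zero _
    · intro τ _ _ h
      have : Equiv.swap a b = 1 := mul_eq_right.1 h
      exact hab (Equiv.swap_eq_one_iff.1 this)
    · intro τ _
      rw [← mul_assoc, Equiv.swap_mul_self, one_mul]
  have all : ∀ j ≤ n, ∑ τ, ∏ i ∈ range n, P 0 τ i = ∑ τ, ∏ i ∈ range n, P j τ i := by
    intro j
    induction j with
    | zero => intro _; rfl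
    | succ j ih => intro hj; rw [ih (by omega), step j (by omega)]
  have h := all n le_rfl
  simp only [P, Nat.not_lt_zero, if_false] at h
  rw [h]
  refine sum_congr rfl fun τ _ => prod_congr rfl fun i hi => ?_
  rw [if_pos (mem_range.1 hi)]

lemma sum_add_sum_shift_eq_boundary {n k : ℕ} (f : (Fin (n + 1) → ℕ) → ZMod 2) (d : Fin (n + 1)) :
    ∑ v : Fin (n + 1) → Fin k,
        (f (fun c => (v c : ℕ) + if c = d then 1 else 0) + f (fun c => (v c : ℕ))) =
      ∑ w : Fin n → Fin k,
        (f (d.insertNth k fun c => (w c : ℕ)) + f (d.insertNth 0 fun c => (w c : ℕ))) := by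
  rw [← (Fin.insertNthEquiv (fun _ => Fin k) d).sum_comp, Fintype.sum_prod_type_right]
  refine sum_congr rfl fun w _ => ?_
  have h1 : ∀ a : Fin k, (fun c => (((Fin.insertNthEquiv (fun _ => Fin k) d) (a, w) c : Fin k) : ℕ)) =
      d.insertNth (a : ℕ) (fun c => (w c : ℕ)) := by
    intro a
    rw [Fin.eq_insertNth_iff]
    constructor
    · simp
    · funext c; simp [Fin.removeNth]
  have h2 : ∀ a : Fin k, (fun c => (((Fin.insertNthEquiv (fun _ => Fin k) d) (a, w) c : Fin k) : ℕ)
      + if c = d then 1 else 0) = d.insertNth ((a : ℕ) + 1) (fun c => (w c : ℕ)) := by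
    intro a
    rw [Fin.eq_insertNth_iff]
    constructor
    · simp
    · funext c; simp [Fin.removeNth, Fin.succAbove_ne]
  simp only [h1, h2]
  rw [Fin.sum_univ_eq_sum_range (fun a => f (d.insertNth (a + 1) fun c => (w c : ℕ)) +
    f (d.insertNth a fun c => (w c : ℕ))) k]
  simp only [← CharTwo.sub_eq_add]
  exact sum_range_sub (fun a => f (d.insertNth a fun c => (w c : ℕ))) k

lemma sum_freudenthal_eq_one (n k : ℕ) (s : ℕ → (Fin n → ℕ) → ZMod 2)
    (h0 : ∀ (i : Fin n) x, x i = 0 → s i x = 0) (h1 : ∀ (i : Fin n) x, x i = k → s i x = 1) :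
    ∑ v : Fin n → Fin k, ∑ τ : Equiv.Perm (Fin n), ∏ i ∈ range n,
      (s i (freudenthalVertex (fun c => (v c : ℕ)) τ (i + 1)) +
        s i (freudenthalVertex (fun c => (v c : ℕ)) τ i)) = 1 := by
  induction n with
  | zero => simp
  | succ n ih =>
    let K (w : Fin (n + 1) → ℕ) (τ : Equiv.Perm (Fin (n + 1))) : ZMod 2 :=
      (∏ i ∈ range n, (s (i + 1) (freudenthalFacetVertex w τ (i + 1)) +
        s (i + 1) (freudenthalFacetVertex w τ i))) * s 0 w
    have hv0 : ∀ (v : Fin (n + 1) → ℕ) τ, freudenthalVertex v τ 0 = v := by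
      intro v τ; funext c; simp [freudenthalVertex]
    have hfacet0 : ∀ (w : Fin (n + 1) → ℕ) τ, freudenthalFacetVertex w τ 0 = w := by
      intro v τ; funext c; simp [freudenthalFacetVertex]; omega
    have hfirst : ∀ (v : Fin (n + 1) → ℕ) (τ : Equiv.Perm (Fin (n + 1))) m,
        freudenthalVertex v τ (m + 1) =
          freudenthalFacetVertex (fun c => v c + if c = τ.symm 0 then 1 else 0) τ m := by
      intro v τ m
      funext c
      have : c = τ.symm 0 ↔ (τ c : ℕ) = 0 := by
        rw [Equiv.eq_symm_apply, Fin.ext_iff]; rfl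
      simp only [freudenthalVertex, freudenthalFacetVertex, this]
      split_ifs <;> omega
    have hlast : ∀ (v : Fin (n + 1) → ℕ) (τ : Equiv.Perm (Fin (n + 1))) m, m ≤ n →
        freudenthalVertex v τ m = freudenthalFacetVertex v (finRotate (n + 1) * τ) m := by
      intro v τ m hm
      funext c
      simp only [freudenthalVertex, freudenthalFacetVertex, Equiv.Perm.coe_mul, Function.comp_apply,
        coe_finRotate, Fin.ext_iff, Fin.val_last]
      have := (τ c).isLt
      split_ifs <;> omega
    have key : ∀ v : Fin (n + 1) → ℕ, ∑ τ : Equiv.Perm (Fin (n + 1)), ∏ i ∈ range (n + 1),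
        (s i (freudenthalVertex v τ (i + 1)) + s i (freudenthalVertex v τ i)) =
        ∑ τ : Equiv.Perm (Fin (n + 1)),
          (K (fun c => v c + if c = τ.symm 0 then 1 else 0) τ + K v τ) := by
      intro v
      simp only [prod_range_succ', mul_add, sum_add_distrib, zero_add, hv0]
      congr 1
      · refine sum_congr rfl fun τ _ => ?_
        simp only [hfirst, K, hfacet0]
      · rw [← sum_mul, sum_freudenthal_prod_shift (fun i => s (i + 1)), sum_mul]
        refine Fintype.sum_equiv (Equiv.mulLeft (finRotate (n + 1))) _ _ fun τ => ?_
        simp only [K, Equiv.coe_mulLeft]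
        congr 1
        refine prod_congr rfl fun i hi => ?_
        have := mem_range.1 hi
        rw [hlast _ _ _ (by omega), hlast _ _ _ (by omega)]
    have hvanish : ∀ (w : Fin (n + 1) → ℕ) (τ : Equiv.Perm (Fin (n + 1))), τ.symm 0 ≠ 0 →
        w (τ.symm 0) = 0 ∨ w (τ.symm 0) = k → K w τ = 0 := by
      intro w τ hτ hw
      obtain ⟨i, hi⟩ := Fin.exists_succ_eq.2 hτ
      refine mul_eq_zero_of_left (prod_eq_zero (mem_range.2 i.isLt) ?_) _
      have hc : ∀ m, freudenthalFacetVertex w τ m i.succ = w (τ.symm 0) := by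
        intro m; simp [freudenthalFacetVertex, hi]
      rcases hw with hw | hw
      · have := fun m => h0 i.succ (freudenthalFacetVertex w τ m) ((hc m).trans hw)
        simp only [Fin.val_succ] at this
        simp [this]
      · have := fun m => h1 i.succ (freudenthalFacetVertex w τ m) ((hc m).trans hw)
        simp only [Fin.val_succ] at this
        simp only [this]
        exact CharTwo.add_self_eq_zero _
    simp only [key]
    rw [sum_comm]
    rw [sum_congr rfl fun τ _ =>
      sum_add_sum_shift_eq_boundary (fun w => K w τ) (τ.symm 0)]
    rw [← Equiv.Perm.decomposeFin.symm.sum_comp, Fintype.sum_prod_type, sum_eq_single 0]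
    · rw [sum_comm, ← ih (fun i w => s (i + 1) (Fin.cons k w))]
      · refine sum_congr rfl fun w _ => sum_congr rfl fun τ _ => ?_
        have hz : (Equiv.Perm.decomposeFin.symm (0, τ)).symm 0 = 0 := by
          rw [Equiv.symm_apply_eq]; simp
        rw [hz]
        have hk : s 0 (Fin.cons k fun c => (w c : ℕ)) = 1 := h1 0 _ rfl
        have hk0 : s 0 (Fin.cons 0 fun c => (w c : ℕ)) = 0 := h0 0 _ rfl
        simp only [K, Fin.insertNth_zero', hk, hk0, mul_zero, mul_one, add_zero]
        have hvert : ∀ m, freudenthalFacetVertex (Fin.cons k fun c => (w c : ℕ))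
            (Equiv.Perm.decomposeFin.symm (0, τ)) m =
            Fin.cons k (freudenthalVertex (fun c => (w c : ℕ)) τ m) := by
          intro m
          funext c
          refine Fin.cases ?_ (fun c => ?_) c
          · simp [freudenthalFacetVertex]
          · simp [freudenthalFacetVertex, freudenthalVertex]
        simp only [hvert]
      · intro i x hx
        exact h0 i.succ _ (by simpa using hx)
      · intro i x hx
        exact h1 i.succ _ (by simpa using hx)
    · intro p _ hp
      refine sum_eq_zero fun e _ => sum_eq_zero fun w _ => ?_
      have hz : (Equiv.Perm.decomposeFin.symm (p, e)).symm 0 ≠ 0 := by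
        intro h
        rw [Equiv.symm_apply_eq] at h
        simp at h
        exact hp h.symm
      rw [hvanish _ _ hz (Or.inr (by simp)), hvanish _ _ hz (Or.inl (by simp)), add_zero]
    · simp

/-- A combinatorial form of the Poincaré–Miranda theorem. -/
lemma exists_freudenthal_simplex_sign_change (n k : ℕ) (s : ℕ → (Fin n → ℕ) → ZMod 2)
    (h0 : ∀ (i : Fin n) x, x i = 0 → s i x = 0) (h1 : ∀ (i : Fin n) x, x i = k → s i x = 1) :
    ∃ (v : Fin n → ℕ) (τ : Equiv.Perm (Fin n)), ∀ i : Fin n,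
      s i (freudenthalVertex v τ (i + 1)) ≠ s i (freudenthalVertex v τ i) := by
  have h := sum_freudenthal_eq_one n k s h0 h1
  obtain ⟨v, -, hv⟩ := exists_ne_zero_of_sum_ne_zero (h ▸ one_ne_zero)
  obtain ⟨τ, -, hτ⟩ := exists_ne_zero_of_sum_ne_zero hv
  refine ⟨fun c => (v c : ℕ), τ, fun i hi => hτ (prod_eq_zero (mem_range.2 i.isLt) ?_)⟩
  rw [hi]
  exact CharTwo.add_self_eq_zero _

end

/-- If the sets `C i` separate the opposite faces of the unit cube, then they have a common point. -/
lemma nonempty_iInter_of_separates_faces {n : ℕ} {C : Fin n → Set (Fin n → unitInterval)}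
    (hC : ∀ i, Separates {x : Fin n → unitInterval | x i = 0} {x | x i = 1} (C i)) :
    (⋂ i, C i).Nonempty := by
  classical
  by_contra hne
  choose U V hU hV hUV hAU hBV hcompl using hC
  obtain ⟨δ, hδ, hball⟩ := lebesgue_number_lemma_of_metric (s := Set.univ)
    (c := Sum.elim U V) isCompact_univ (by rintro (i | i) <;> simp [hU, hV]) (by
      intro x _
      have hx : x ∉ ⋂ i, C i := fun h => hne ⟨x, h⟩
      obtain ⟨i, hi⟩ := Set.mem_iInter.not.trans not_forall |>.1 hx
      have : x ∈ U i ∪ V i := hcompl i ▸ ⟨trivial, hi⟩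
      rcases this with h | h
      · exact Set.mem_iUnion.2 ⟨Sum.inl i, h⟩
      · exact Set.mem_iUnion.2 ⟨Sum.inr i, h⟩)
  obtain ⟨k, hk⟩ := exists_nat_one_div_lt hδ
  have hk0 : (0 : ℝ) < (k : ℝ) + 1 := by positivity
  let P : (Fin n → ℕ) → Fin n → unitInterval :=
    fun x i => Set.projIcc (0 : ℝ) 1 zero_le_one ((x i : ℝ) / ((k : ℝ) + 1))
  have hP0 : ∀ i x, x i = 0 → P x i = 0 := by
    intro i x hx
    simp only [P, hx, Nat.cast_zero, zero_div]
    exact Set.projIcc_left zero_le_one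
  have hP1 : ∀ i x, x i = k + 1 → P x i = 1 := by
    intro i x hx
    simp only [P, hx, Nat.cast_add, Nat.cast_one, div_self hk0.ne']
    exact Set.projIcc_right zero_le_one
  let s : ℕ → (Fin n → ℕ) → ZMod 2 :=
    fun i x => if h : i < n then (if P x ∈ U ⟨i, h⟩ then 0 else 1) else 0
  have hs : ∀ (i : Fin n) x, s i x = if P x ∈ U i then 0 else 1 := by
    intro i x; simp [s]
  obtain ⟨v, τ, hvτ⟩ := exists_freudenthal_simplex_sign_change n (k + 1) s
    (by
      intro i x hx
      rw [hs, if_pos (hAU i (hP0 i x hx))])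
    (by
      intro i x hx
      rw [hs, if_neg fun h => Set.disjoint_left.1 (hUV i) h (hBV i (hP1 i x hx))])
  have hmem : ∀ m, P (freudenthalVertex v τ m) ∈ Metric.ball (P v) δ := by
    intro m
    refine Metric.mem_ball.2 (((dist_pi_le_iff (by positivity)).2 fun i => ?_).trans_lt hk)
    refine (LipschitzWith.projIcc zero_le_one).dist_le_mul _ _ |>.trans ?_
    rw [Real.dist_eq, ← sub_div, abs_div, abs_of_pos hk0, NNReal.coe_one, one_mul]
    gcongr
    simp only [freudenthalVertex]
    split_ifs <;> simp
  obtain ⟨i | i, hi⟩ := hball (P v) trivial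
  · replace hi : Metric.ball (P v) δ ⊆ U i := hi
    refine hvτ i ?_
    rw [hs, hs, if_pos (hi (hmem _)), if_pos (hi (hmem _))]
  · replace hi : Metric.ball (P v) δ ⊆ V i := hi
    refine hvτ i ?_
    rw [hs, hs, if_neg fun h => Set.disjoint_left.1 (hUV i) h (hi (hmem _)),
      if_neg fun h => Set.disjoint_left.1 (hUV i) h (hi (hmem _))]

lemma exists_contDiff_approx_on_unitCube {n : ℕ} (f : C(Fin n → unitInterval, ℝ)) {ε : ℝ}
    (hε : 0 < ε) :
    ∃ g : (Fin n → ℝ) → ℝ, ContDiff ℝ 1 g ∧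
      ∀ x : Fin n → unitInterval, |g (fun i => (x i : ℝ)) - f x| < ε := by
  let coord : Fin n → C(Fin n → unitInterval, ℝ) := fun i => ⟨fun x => (x i : ℝ), by fun_prop⟩
  let φ : MvPolynomial (Fin n) ℝ →ₐ[ℝ] C(Fin n → unitInterval, ℝ) := MvPolynomial.aeval coord
  obtain ⟨⟨q, p, hp⟩, hq⟩ :=
    ContinuousMap.exists_mem_subalgebra_near_continuousMap_of_separatesPoints φ.range (by
      intro x y hxy
      obtain ⟨i, hi⟩ := Function.ne_iff.1 hxy
      refine ⟨coord i, ⟨coord i, ⟨MvPolynomial.X i, ?_⟩, rfl⟩, ?_⟩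
      · exact MvPolynomial.aeval_X _ _
      · simpa [coord, Subtype.ext_iff] using hi) f ε hε
  refine ⟨fun y => MvPolynomial.eval y p, ?_, fun x => ?_⟩
  · exact (AnalyticOnNhd.eval_mvPolynomial p).contDiff
  · have h : MvPolynomial.eval (fun i => (x i : ℝ)) p = q x := by
      rw [← hp]
      have : (ContinuousMap.evalAlgHom ℝ ℝ x).comp φ =
          MvPolynomial.aeval (fun i => (x i : ℝ)) := by
        ext i
        simp [φ, coord]
      exact (DFunLike.congr_fun this p).symm
    simp only [h]
    exact (ContinuousMap.norm_coe_le_norm (q - f) x).trans_lt hq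

lemma exists_separates_iInter_eq_empty {n : ℕ} {A B : Fin (n + 1) → Set (Fin n → unitInterval)}
    (hA : ∀ i, IsClosed (A i)) (hB : ∀ i, IsClosed (B i)) (hAB : ∀ i, A i ∩ B i = ∅) :
    ∃ C : Fin (n + 1) → Set (Fin n → unitInterval),
      (∀ i, IsClosed (C i) ∧ Separates (A i) (B i) (C i)) ∧ ⋂ i, C i = ∅ := by
  have hurysohn := fun i => exists_continuous_zero_one_of_isClosed (hA i) (hB i)
    (Set.disjoint_iff_inter_eq_empty.2 (hAB i))
  choose f hf0 hf1 hf using hurysohn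
  have happrox := fun i => exists_contDiff_approx_on_unitCube (f i) (ε := 1 / 4) (by norm_num)
  choose g hg hgf using happrox
  have hdense := (contDiff_pi.2 hg).dense_compl_range_of_finrank_lt_finrank (by simp)
  obtain ⟨y, hy, hyr⟩ := hdense.exists_dist_lt (fun _ : Fin (n + 1) => (1 / 2 : ℝ))
    (ε := 1 / 4) (by norm_num)
  have hyi : ∀ i, |1 / 2 - y i| < 1 / 4 := fun i =>
    (dist_le_pi_dist (fun _ : Fin (n + 1) => (1 / 2 : ℝ)) y i).trans_lt hyr
  have hcont : ∀ i, Continuous fun x : Fin n → unitInterval => g i fun j => (x j : ℝ) := fun i =>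
    (hg i).continuous.comp (by fun_prop)
  refine ⟨fun i => {x | g i (fun j => (x j : ℝ)) = y i}, fun i =>
    ⟨isClosed_eq (hcont i) continuous_const, {x | g i (fun j => (x j : ℝ)) < y i},
      {x | y i < g i (fun j => (x j : ℝ))}, isOpen_lt (hcont i) continuous_const,
      isOpen_lt continuous_const (hcont i), ?_, fun x hx => ?_, fun x hx => ?_, ?_⟩, ?_⟩
  · exact Set.disjoint_left.2 fun x hx hx' => by
      simp only [Set.mem_ofPred_eq] at hx hx'
      exact lt_asymm hx hx'
  · have h1 := abs_lt.1 (hgf i x)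
    have h2 := abs_lt.1 (hyi i)
    rw [hf0 i hx] at h1
    simp only [Pi.zero_apply] at h1
    simp only [Set.mem_ofPred_eq]
    linarith
  · have h1 := abs_lt.1 (hgf i x)
    have h2 := abs_lt.1 (hyi i)
    rw [hf1 i hx] at h1
    simp only [Pi.one_apply] at h1
    simp only [Set.mem_ofPred_eq]
    linarith
  · ext x
    simp
  · refine Set.eq_empty_of_forall_notMem fun x hx => hy ⟨fun j => (x j : ℝ), ?_⟩
    funext i
    exact Set.mem_iInter.1 hx i

/-- **The separation-dimension of `[0,1]^n` equals `n`.**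
Upper bound: for any `n+1` pairs of disjoint closed sets `A_i, B_i ⊆ [0,1]^n` there are
closed sets `C_i` separating `A_i` and `B_i` with `⋂_i C_i = ∅`.
Lower bound (for `n ≥ 1`): there exist `n` pairs of disjoint closed sets `A_i, B_i` such that
all closed sets `C_i` separating `A_i` and `B_i` satisfy `⋂_i C_i ≠ ∅`. -/
theorem sdim_unitCube_eq (n : ℕ) :
    (∀ A B : Fin (n + 1) → Set (Fin n → unitInterval),
      (∀ i, IsClosed (A i)) → (∀ i, IsClosed (B i)) → (∀ i, A i ∩ B i = ∅) →
      ∃ C : Fin (n + 1) → Set (Fin n → unitInterval),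
        (∀ i, IsClosed (C i) ∧ Separates (A i) (B i) (C i)) ∧ ⋂ i, C i = ∅) ∧
    (1 ≤ n →
      ∃ A B : Fin n → Set (Fin n → unitInterval),
        (∀ i, IsClosed (A i)) ∧ (∀ i, IsClosed (B i)) ∧ (∀ i, A i ∩ B i = ∅) ∧
        ∀ C : Fin n → Set (Fin n → unitInterval),
          (∀ i, IsClosed (C i)) → (∀ i, Separates (A i) (B i) (C i)) →
          (⋂ i, C i).Nonempty) := by
  refine ⟨fun A B => exists_separates_iInter_eq_empty, fun _ =>
    ⟨fun i => {x | x i = 0}, fun i => {x | x i = 1}, fun i => ?_, fun i => ?_, fun i => ?_,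
      fun C _ hC => nonempty_iInter_of_separates_faces hC⟩⟩
  · exact isClosed_eq (continuous_apply i) continuous_const
  · exact isClosed_eq (continuous_apply i) continuous_const
  · refine Set.eq_empty_of_forall_notMem fun x hx => zero_ne_one (α := unitInterval) ?_
    exact hx.1.symm.trans hx.2
end

section
/- (Invariance of dimension for cubes) The cubes [0,1]^n and [0,1]^m are homeomorphic if and only if n = m. -/
open Metric Set Module MeasureTheory Polynomial

theorem LipschitzOnWith.lipschitzWith_indicator_of_frontier {E F : Type*}
    [NormedAddCommGroup E] [NormedSpace ℝ E] [SeminormedAddCommGroup F] {K : NNReal} {f : E → F}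
    {s : Set E} (hf : LipschitzOnWith K f s) (hs : IsClosed s) (h0 : ∀ x ∈ frontier s, f x = 0) :
    LipschitzWith K (s.indicator f) := by
  have key : ∀ x ∈ s, ∀ y ∉ s, ‖f x‖ ≤ K * dist x y := by
    intro x hx y hy
    obtain ⟨z, hz, hzs⟩ : (segment ℝ x y ∩ frontier s).Nonempty := by
      by_contra! hne
      have hinterior : ∀ z ∈ segment ℝ x y, z ∈ s → z ∈ interior s := fun z hz hzs => by
        by_contra hzi
        exact (hne ▸ ⟨hz, subset_closure hzs, hzi⟩ : z ∈ (∅ : Set E))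
      obtain ⟨z, -, hzi, hzs⟩ := (convex_segment x y).isPreconnected (interior s) sᶜ
        isOpen_interior hs.isOpen_compl
        (fun z hz => (em (z ∈ s)).imp (hinterior z hz) id)
        ⟨x, left_mem_segment ℝ x y, hinterior x (left_mem_segment ℝ x y) hx⟩
        ⟨y, right_mem_segment ℝ x y, hy⟩
      exact hzs (interior_subset hzi)
    have h1 := hf.dist_le_mul x hx z (hs.frontier_subset hzs)
    rw [h0 z hzs, dist_zero_right] at h1
    have h2 := dist_add_dist_of_mem_segment hz
    exact h1.trans (by gcongr; linarith [dist_nonneg (x := z) (y := y)])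
  refine LipschitzWith.of_dist_le_mul fun x y => ?_
  by_cases hx : x ∈ s <;> by_cases hy : y ∈ s
  · simpa [hx, hy] using hf.dist_le_mul x hx y hy
  · simpa [hx, hy] using key x hx y hy
  · simpa [hx, hy, dist_comm] using key y hy x hx
  · simp only [hx, hy, not_false_eq_true, indicator_of_notMem, dist_self]
    positivity

theorem LinearMap.exists_natDegree_le_eval_eq_det_one_add_smul {R M : Type*} [CommRing R]
    [Nontrivial R] [AddCommGroup M] [Module R M] [Module.Free R M] [Module.Finite R M]
    (A : M →ₗ[R] M) :
    ∃ p : R[X], p.natDegree ≤ finrank R M ∧ ∀ t, p.eval t = LinearMap.det (1 + t • A) := by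
  classical
  let b := Module.finBasis R M
  let B := LinearMap.toMatrix b b A
  refine ⟨Matrix.det ((X : R[X]) • B.map C + (1 : Matrix _ _ R).map C),
    (natDegree_det_X_add_C_le B 1).trans (by simp), fun t => ?_⟩
  rw [← LinearMap.det_toMatrix b, ← coe_evalRingHom, RingHom.map_det]
  congr 1
  ext i j
  by_cases h : i = j <;> simp [B, h] <;> ring

/-- Lagrange interpolation of the polynomial `t ↦ det (1 + t • A)` at `t = 1` from small nodes, with
weights independent of `A`. -/
theorem exists_lagrange_det_one_add {E : Type*}
    [AddCommGroup E] [Module ℝ E] [FiniteDimensional ℝ E] {η : ℝ} (hη : 0 < η) :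
    ∃ (s : Finset ℝ) (c : ℝ → ℝ), (∀ t ∈ s, 0 < t ∧ t < η) ∧ ∑ t ∈ s, c t = 1 ∧
      ∀ A : E →ₗ[ℝ] E, LinearMap.det (1 + A) = ∑ t ∈ s, c t * LinearMap.det (1 + t • A) := by
  obtain ⟨s, hsub, hcard⟩ := (Ioo_infinite hη).exists_subset_card_eq (finrank ℝ E + 1)
  have hinj : Set.InjOn (id : ℝ → ℝ) s := injOn_id _
  refine ⟨s, fun t => (Lagrange.basis s id t).eval 1, fun t ht => hsub ht, ?_, fun A => ?_⟩
  · rw [← eval_finsetSum, Lagrange.sum_basis hinj (Finset.card_pos.1 (by omega)), eval_one]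
  · obtain ⟨p, hp, hpe⟩ := A.exists_natDegree_le_eval_eq_det_one_add_smul
    have hlt : p.degree < s.card := by
      rw [hcard]
      exact (degree_le_of_natDegree_le hp).trans_lt (by exact_mod_cast Nat.lt_succ_self _)
    have h := congrArg (eval 1) (Lagrange.eq_interpolate hinj hlt)
    rw [hpe, one_smul, Lagrange.interpolate_apply, eval_finsetSum] at h
    simpa [hpe, mul_comm] using h

theorem det_fderiv_eq_zero_of_norm_eq_const {E : Type*} [NormedAddCommGroup E]
    [InnerProductSpace ℝ E] [FiniteDimensional ℝ E] {r : E → E} {c : ℝ} (hc : c ≠ 0)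
    (hr : Differentiable ℝ r) (h : ∀ x, ‖r x‖ = c) (x : E) :
    LinearMap.det (fderiv ℝ r x : E →ₗ[ℝ] E) = 0 := by
  by_contra hdet
  have horth : ∀ v, inner ℝ (r x) (fderiv ℝ r x v) = 0 := by
    intro v
    have h1 := (hr x).hasFDerivAt.norm_sq
    simp only [h] at h1
    have h2 := congrArg (fun L => L v) (h1.unique (hasFDerivAt_const (c ^ 2) x))
    simpa using h2
  obtain ⟨v, hv⟩ := (LinearMap.equivOfDetNeZero _ hdet).surjective (r x)
  have h3 := horth v
  have h4 : fderiv ℝ r x v = r x := hv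
  rw [h4, real_inner_self_eq_norm_sq, h] at h3
  exact hc (pow_eq_zero_iff two_ne_zero |>.1 h3)

/-- If `g` is Lipschitz and vanishes off `s`, a small perturbation `x ↦ x + t • g x` of the identity
permutes the points of `s`. -/
theorem LipschitzWith.bijOn_add_smul_of_support_subset {E : Type*} [NormedAddCommGroup E]
    [NormedSpace ℝ E] [CompleteSpace E] {K : NNReal} {g : E → E} {s : Set E}
    (hg : LipschitzWith K g) (hs : ∀ x ∉ s, g x = 0) {t : ℝ} (ht : |t| * K < 1) :
    BijOn (fun x => x + t • g x) s s := by
  have happ : ApproximatesLinearOn (fun x => x + t • g x)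
      ((ContinuousLinearEquiv.refl ℝ E : E ≃L[ℝ] E) : E →L[ℝ] E) univ (‖t‖₊ * K) := by
    refine LipschitzOnWith.approximatesLinearOn ?_
    rw [lipschitzOnWith_univ]
    have heq : (fun x => x + t • g x) -
        ⇑((ContinuousLinearEquiv.refl ℝ E : E ≃L[ℝ] E) : E →L[ℝ] E) = fun x => t • g x := by
      funext x
      simp
    rw [heq]
    exact (lipschitzWith_smul t).comp hg
  have hc : Subsingleton E ∨
      ‖t‖₊ * K < ‖((ContinuousLinearEquiv.refl ℝ E).symm : E →L[ℝ] E)‖₊⁻¹ := by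
    rcases subsingleton_or_nontrivial E with h | h
    · exact Or.inl h
    · right
      have h1 : ‖((ContinuousLinearEquiv.refl ℝ E).symm : E →L[ℝ] E)‖₊ = 1 := by
        ext
        exact ContinuousLinearMap.norm_id
      rw [h1, inv_one, ← NNReal.coe_lt_coe]
      simpa using ht
  have hinj : Function.Injective fun x => x + t • g x := injOn_univ.1 (happ.injOn hc)
  have hfix : ∀ x ∉ s, x + t • g x = x := fun x hx => by simp [hs x hx]
  refine ⟨fun x hx => ?_, hinj.injOn, fun y hy => ?_⟩
  · by_contra hx'
    have := hinj (hfix _ hx')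
    exact hx' (this.symm ▸ hx)
  · obtain ⟨x, rfl⟩ := happ.surjective hc y
    refine ⟨x, ?_, rfl⟩
    by_contra hx
    exact hx (hfix x hx ▸ hy)

theorem setIntegral_det_one_add_smul_eq_volume {E : Type*} [NormedAddCommGroup E]
    [NormedSpace ℝ E] [FiniteDimensional ℝ E] [MeasurableSpace E] [BorelSpace E]
    (μ : Measure E) [μ.IsAddHaarMeasure] {s : Set E} (hs : MeasurableSet s) {g : E → E}
    {g' : E → E →L[ℝ] E} {t : ℝ} (hg : ∀ x ∈ s, HasFDerivAt g (g' x) x)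
    (hbij : BijOn (fun x => x + t • g x) s s)
    (hpos : ∀ x ∈ s, 0 < LinearMap.det (1 + t • (g' x : E →ₗ[ℝ] E))) :
    ∫ x in s, LinearMap.det (1 + t • (g' x : E →ₗ[ℝ] E)) ∂μ = μ.real s := by
  have hd : ∀ x ∈ s, HasFDerivWithinAt (fun x => x + t • g x)
      (ContinuousLinearMap.id ℝ E + t • g' x) s x := fun x hx =>
    ((hasFDerivAt_id x).add ((hg x hx).const_smul t)).hasFDerivWithinAt
  have h := integral_image_eq_integral_abs_det_fderiv_smul μ hs hd hbij.injOn fun _ => (1 : ℝ)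
  rw [hbij.image_eq, setIntegral_const, smul_eq_mul, mul_one] at h
  rw [h]
  refine setIntegral_congr_fun hs fun x hx => ?_
  have h1 : (ContinuousLinearMap.id ℝ E + t • g' x).det =
    LinearMap.det (1 + t • (g' x : E →ₗ[ℝ] E)) := rfl
  simp only [h1, smul_eq_mul, mul_one]
  exact (abs_of_pos (hpos x hx)).symm

/-- There is no `C¹` retraction of a Euclidean space onto its unit sphere, even if only points of
the sphere are required to be fixed. -/
theorem not_contDiff_retraction_sphere {E : Type*} [NormedAddCommGroup E] [InnerProductSpace ℝ E]
    [FiniteDimensional ℝ E] {r : E → E} (hr : ContDiff ℝ 1 r) (h1 : ∀ x, ‖r x‖ = 1)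
    (hfix : ∀ x, ‖x‖ = 1 → r x = x) : False := by
  borelize E
  let μ : Measure E := Measure.addHaar
  have hrd : Differentiable ℝ r := hr.differentiable one_ne_zero
  let g : E → E := fun x => r x - x
  have hgc : ContDiff ℝ 1 g := hr.sub contDiff_id
  obtain ⟨K, hK⟩ := hgc.contDiffOn.exists_lipschitzOnWith one_ne_zero
    (convex_closedBall (0 : E) 1) (isCompact_closedBall 0 1)
  have hg0 : ∀ x, ‖x‖ = 1 → g x = 0 := fun x hx => sub_eq_zero.2 (hfix x hx)
  have hKG : LipschitzWith K ((closedBall (0 : E) 1).indicator g) :=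
    hK.lipschitzWith_indicator_of_frontier isClosed_closedBall fun x hx =>
      hg0 x (by simpa using frontier_closedBall_subset_sphere hx)
  have hbound : ∀ x ∈ ball (0 : E) 1, ‖fderiv ℝ g x‖ ≤ K := fun x hx =>
    norm_fderiv_le_of_lipschitzOn ℝ (closedBall_mem_nhds_of_mem hx) hK
  obtain ⟨δ, hδ, hdet⟩ : ∃ δ > 0, ∀ A : E →L[ℝ] E, ‖A‖ < δ →
      0 < LinearMap.det (1 + (A : E →ₗ[ℝ] E)) := by
    have hc : Continuous fun A : E →L[ℝ] E => (1 + A).det :=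
      ContinuousLinearMap.continuous_det.comp (continuous_const.add continuous_id)
    have h0 : (0 : ℝ) < (1 + (0 : E →L[ℝ] E)).det := by
      rw [add_zero]
      exact one_pos.trans_eq (LinearMap.det_id (A := ℝ) (M := E)).symm
    obtain ⟨δ, hδ, h⟩ := Metric.eventually_nhds_iff.1 (hc.continuousAt.eventually_const_lt h0)
    exact ⟨δ, hδ, fun A hA => h (by simpa using hA)⟩
  have hK1 : (0 : ℝ) < K + 1 := by positivity
  obtain ⟨s, c, hs, hc, hsum⟩ := exists_lagrange_det_one_add (E := E)
    (show 0 < min δ 1 / (K + 1) by positivity)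
  have hsmall : ∀ t ∈ s, |t| * K < min δ 1 := fun t ht => by
    rw [abs_of_pos (hs t ht).1]
    have := (lt_div_iff₀ hK1).1 (hs t ht).2
    nlinarith [(hs t ht).1]
  have hvol : ∀ t ∈ s, ∫ x in ball (0 : E) 1,
      LinearMap.det (1 + t • (fderiv ℝ g x : E →ₗ[ℝ] E)) ∂μ = μ.real (ball (0 : E) 1) := by
    intro t ht
    refine setIntegral_det_one_add_smul_eq_volume μ measurableSet_ball
      (fun x _ => (hgc.differentiable one_ne_zero x).hasFDerivAt) ?_ fun x hx => ?_
    · refine (hKG.bijOn_add_smul_of_support_subset (s := ball 0 1) (t := t) (fun x hx => ?_)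
        ((hsmall t ht).trans_le (min_le_right _ _))).congr fun x hx => ?_
      · by_cases hx1 : x ∈ closedBall (0 : E) 1
        · rw [indicator_of_mem hx1]
          exact hg0 x (le_antisymm (by simpa using hx1) (by simpa using hx))
        · exact indicator_of_notMem hx1 _
      · simp only [indicator_of_mem (ball_subset_closedBall hx)]
    · refine hdet (t • fderiv ℝ g x) ?_
      rw [norm_smul, Real.norm_eq_abs]
      exact (mul_le_mul_of_nonneg_left (hbound x hx) (abs_nonneg t)).trans_lt
        ((hsmall t ht).trans_le (min_le_left _ _))
  have hintegrable : ∀ t : ℝ, IntegrableOn (fun x => LinearMap.det (1 + t • (fderiv ℝ g x : E →ₗ[ℝ] E)))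
      (ball 0 1) μ := by
    intro t
    have hcont : Continuous fun x => (1 + t • fderiv ℝ g x).det :=
      ContinuousLinearMap.continuous_det.comp
        (continuous_const.add ((hgc.continuous_fderiv one_ne_zero).const_smul t))
    exact (hcont.continuousOn.integrableOn_compact (isCompact_closedBall 0 1)).mono_set
      ball_subset_closedBall
  have hzero : ∀ x, LinearMap.det (1 + (fderiv ℝ g x : E →ₗ[ℝ] E)) = 0 := by
    intro x
    rw [← det_fderiv_eq_zero_of_norm_eq_const one_ne_zero hrd h1 x]
    congr 1
    have : fderiv ℝ g x = fderiv ℝ r x - ContinuousLinearMap.id ℝ E :=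
      ((hrd x).hasFDerivAt.sub (hasFDerivAt_id x)).fderiv
    rw [this]
    ext v
    simp
  have hcalc : (0 : ℝ) = μ.real (ball (0 : E) 1) := calc
    (0 : ℝ) = ∫ x in ball (0 : E) 1, LinearMap.det (1 + (fderiv ℝ g x : E →ₗ[ℝ] E)) ∂μ := by
      simp [hzero]
    _ = ∑ t ∈ s, c t * ∫ x in ball (0 : E) 1,
          LinearMap.det (1 + t • (fderiv ℝ g x : E →ₗ[ℝ] E)) ∂μ := by
      rw [integral_congr_ae (.of_forall fun x => hsum _),
        integral_finsetSum _ fun t _ => (hintegrable t).const_mul (c t)]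
      simp_rw [integral_const_mul]
    _ = μ.real (ball (0 : E) 1) := by
      rw [Finset.sum_congr rfl fun t ht => by rw [hvol t ht], ← Finset.sum_mul, hc, one_mul]
  have hpos : 0 < μ.real (ball (0 : E) 1) :=
    ENNReal.toReal_pos (measure_ball_pos μ 0 one_pos).ne' measure_ball_lt_top.ne
  exact hpos.ne hcalc

/-- A continuous self-map of a Euclidean space that moves points of the unit ball by less than
`1 / 2` has a zero. -/
theorem exists_eq_zero_of_norm_sub_lt {E : Type*} [NormedAddCommGroup E] [InnerProductSpace ℝ E]
    [FiniteDimensional ℝ E] {g : E → E} (hg : Continuous g)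
    (h : ∀ x, ‖x‖ ≤ 1 → ‖g x - x‖ < 1 / 2) : ∃ x, g x = 0 := by
  by_contra! hne
  let χ : E → ℝ := fun x => max 0 (min 1 (2 - 2 * ‖x‖))
  let q : E → E := fun x => x + χ x • (g x - x)
  have hχ0 : ∀ x, 0 ≤ χ x := fun x => le_max_left _ _
  have hχ1 : ∀ x, χ x ≤ 1 := fun x => max_le zero_le_one (min_le_left _ _)
  have hq : Continuous q := by fun_prop
  have hq_out : ∀ x, 1 ≤ ‖x‖ → q x = x := fun x hx => by
    have : χ x = 0 := max_eq_left ((min_le_right _ _).trans (by linarith))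
    simp [q, this]
  have hq_ne : ∀ x, q x ≠ 0 := by
    intro x hx
    rcases le_or_gt ‖x‖ (1 / 2) with hx2 | hx2
    · have : χ x = 1 := by
        simp only [χ]
        rw [min_eq_left (by linarith), max_eq_right zero_le_one]
      exact hne x (by simpa [q, this] using hx)
    · rcases le_or_gt 1 ‖x‖ with hx1 | hx1
      · rw [hq_out x hx1] at hx
        rw [hx, norm_zero] at hx1
        linarith
      · have h1 : ‖x‖ = χ x * ‖g x - x‖ := by
          rw [eq_neg_of_add_eq_zero_left hx, norm_neg, ← eq_neg_of_add_eq_zero_left hx, norm_smul,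
            Real.norm_of_nonneg (hχ0 x)]
        have h2 := mul_le_of_le_one_left (norm_nonneg (g x - x)) (hχ1 x)
        linarith [h x hx1.le]
  obtain ⟨p, hp, hpq, hp_eq, -⟩ := hq.exists_contDiff_approx_and_eqOn 1 (ε := fun x => ‖q x‖)
    hq.norm (fun x => norm_pos_iff.2 (hq_ne x)) (S := {x | 2 ≤ ‖x‖}) (U := {x | 1 < ‖x‖})
    (isClosed_le continuous_const continuous_norm)
    ((isOpen_lt continuous_const continuous_norm).mem_nhdsSet.2 fun x (hx : 2 ≤ ‖x‖) =>
      show 1 < ‖x‖ by linarith)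
    (contDiffOn_id.congr fun x hx => hq_out x (le_of_lt hx))
  have hp_ne : ∀ x, p x ≠ 0 := fun x hx => by
    have := hpq x
    rw [hx, dist_zero_left] at this
    exact lt_irrefl _ this
  have hp2 : ContDiff ℝ 1 fun x => p ((2 : ℝ) • x) := hp.comp (contDiff_const_smul _)
  refine not_contDiff_retraction_sphere
    (r := fun x => ‖p ((2 : ℝ) • x)‖⁻¹ • p ((2 : ℝ) • x)) ?_ (fun x => ?_) fun x hx => ?_
  · exact ((hp2.norm ℝ fun x => hp_ne _).inv fun x => norm_ne_zero_iff.2 (hp_ne _)).smul hp2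
  · rw [norm_smul, norm_inv, norm_norm, inv_mul_cancel₀ (norm_ne_zero_iff.2 (hp_ne _))]
  · have h2 : ‖(2 : ℝ) • x‖ = 2 := by simp [norm_smul, hx]
    have : p ((2 : ℝ) • x) = (2 : ℝ) • x := by
      rw [hp_eq (show 2 ≤ ‖(2 : ℝ) • x‖ from h2.ge), hq_out _ (by rw [h2]; norm_num)]
    simp only [this, h2]
    simp [smul_smul]

/-- The unit ball of a Euclidean space does not factor through a space of smaller dimension. -/
theorem exists_comp_ne_of_finrank_lt {E F : Type*} [NormedAddCommGroup E] [InnerProductSpace ℝ E]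
    [FiniteDimensional ℝ E] [NormedAddCommGroup F] [NormedSpace ℝ F] [FiniteDimensional ℝ F]
    (hEF : finrank ℝ F < finrank ℝ E) {a : E → F} {b : F → E} (ha : Continuous a)
    (hb : Continuous b) : ∃ x, ‖x‖ ≤ 1 ∧ b (a x) ≠ x := by
  by_contra! h
  obtain ⟨p, hp, hpb, -⟩ := hb.exists_contDiff_approx 1 (ε := fun _ => 1 / 4) continuous_const
    fun _ => by norm_num
  obtain ⟨c, hc, hcp⟩ := (hp.dense_compl_range_of_finrank_lt_finrank hEF).exists_dist_lt 0
    (show (0 : ℝ) < 1 / 4 by norm_num)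
  obtain ⟨x, hx⟩ := exists_eq_zero_of_norm_sub_lt (g := fun x => p (a x) - c)
    ((hp.continuous.comp ha).sub continuous_const) fun x hx => by
      have h1 := hpb (a x)
      rw [h x hx, dist_eq_norm] at h1
      rw [dist_zero_left] at hcp
      calc ‖p (a x) - c - x‖ = ‖(p (a x) - x) - c‖ := by rw [sub_right_comm]
        _ ≤ ‖p (a x) - x‖ + ‖c‖ := norm_sub_le _ _
        _ < 1 / 2 := by linarith
  exact hc ⟨a x, sub_eq_zero.1 hx⟩

theorem le_of_cube_homeomorph {n m : ℕ}
    (h : (Fin m → unitInterval) ≃ₜ (Fin n → unitInterval)) : m ≤ n := by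
  by_contra! hlt
  let a : EuclideanSpace ℝ (Fin m) → (Fin n → ℝ) := fun x j =>
    h (fun i => projIcc 0 1 zero_le_one ((x i + 1) / 2)) j
  let b : (Fin n → ℝ) → EuclideanSpace ℝ (Fin m) := fun y =>
    WithLp.toLp 2 fun i => 2 * (h.symm (fun j => projIcc 0 1 zero_le_one (y j)) i : ℝ) - 1
  have ha : Continuous a := by fun_prop
  have hb : Continuous b := by fun_prop
  obtain ⟨x, hx, hne⟩ := exists_comp_ne_of_finrank_lt (by simpa using hlt) ha hb
  refine hne ?_
  ext i
  have hi : |x i| ≤ 1 := (PiLp.norm_apply_le x i).trans hx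
  obtain ⟨hi1, hi2⟩ := abs_le.1 hi
  have hmem : (x i + 1) / 2 ∈ Icc (0 : ℝ) 1 := ⟨by linarith, by linarith⟩
  simp only [a, b, projIcc_val, Homeomorph.symm_apply_apply]
  rw [projIcc_of_mem _ hmem]
  ring

/-- **Invariance of dimension for cubes.** The cubes `[0,1]^n` and `[0,1]^m` are
homeomorphic if and only if `n = m`. -/
theorem cube_homeomorph_iff_eq (n m : ℕ) :
    Nonempty ((Fin n → unitInterval) ≃ₜ (Fin m → unitInterval)) ↔ n = m := by
  constructor
  · rintro ⟨h⟩
    exact le_antisymm (le_of_cube_homeomorph h) (le_of_cube_homeomorph h.symm)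
  · rintro rfl
    exact ⟨Homeomorph.refl _⟩
end
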